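/- arXiv:2408.12858 — 2 statements merged into one kernel-verified Lean document; each statement's English description precedes it below -/
import Mathlib

section
/- Let n ≥ 2 and let F₁, F₂ : ℂ → ℂⁿ be polynomial maps with F₁(0) = F₂(0) = 0, and set v₁(z) = (1,0,F₁(z)), v₂(z) = (0,1,F₂(z)) ∈ ℂ^{n+2}. Assume: (i) linear fullness, i.e. the ℂ-linear span of {v₁(z), v₂(z) : z ∈ ℂ} is all of ℂ^{n+2}; (ii) condition (A)₄ holds; (iii) condition (B)_{4,c} holds for some constant c > 0. Then n = 4, and there exist t ∈ (0,3] and a unitary matrix U ∈ U(6) such that for every z ∈ ℂ, span_ℂ{U v₁(z), U v₂(z)} = span_ℂ{v₁ᵗ(z), v₂ᵗ(z)}; moreover c = 4t − t² (equivalently, the squared norm of the second fundamental form is S = t² − 4t + 6). -/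
open scoped BigOperators
open Complex

noncomputable def hinner {m : ℕ} (u w : Fin m → ℂ) : ℂ :=
  ∑ i, u i * (starRingEnd ℂ) (w i)

noncomputable def gram {m k : ℕ} (v : Fin k → Fin m → ℂ) : ℂ :=
  Matrix.det (Matrix.of fun i j : Fin k => hinner (v i) (v j))

noncomputable def vOne {n : ℕ} (F : ℂ → Fin n → ℂ) (z : ℂ) : Fin (n + 2) → ℂ :=
  Fin.cons 1 (Fin.cons 0 (F z))

noncomputable def vTwo {n : ℕ} (F : ℂ → Fin n → ℂ) (z : ℂ) : Fin (n + 2) → ℂ :=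
  Fin.cons 0 (Fin.cons 1 (F z))

def IsPolyMap {n : ℕ} (F : ℂ → Fin n → ℂ) : Prop :=
  ∀ i : Fin n, ∃ p : Polynomial ℂ, ∀ z : ℂ, F z i = Polynomial.eval z p

def CondA {n : ℕ} (d : ℕ) (F₁ F₂ : ℂ → Fin n → ℂ) : Prop :=
  ∀ z : ℂ,
    1 + hinner (F₁ z) (F₁ z) + hinner (F₂ z) (F₂ z) +
      (hinner (F₁ z) (F₁ z) * hinner (F₂ z) (F₂ z) -
        hinner (F₁ z) (F₂ z) * (starRingEnd ℂ) (hinner (F₁ z) (F₂ z))) =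
    (1 + (Complex.normSq z : ℂ)) ^ d

def CondB {n : ℕ} (d : ℕ) (c : ℝ) (F₁ F₂ : ℂ → Fin n → ℂ) : Prop :=
  ∀ z : ℂ,
    gram ![vOne F₁ z, vTwo F₂ z, deriv (vOne F₁) z, deriv (vTwo F₂) z] =
      (c : ℂ) * (1 + (Complex.normSq z : ℂ)) ^ (2 * d - 4)

noncomputable def F1t (t : ℝ) (z : ℂ) : Fin 4 → ℂ :=
  ![(|t - 2| : ℝ) * z ^ 3, (Real.sqrt t : ℝ) * z,
    ((Real.sqrt ((3 - t) / (4 - t)) * |t - 2| : ℝ)) * z ^ 2,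
    ((Real.sqrt (t / (4 - t)) : ℝ)) * z ^ 2]

noncomputable def F2t (t : ℝ) (z : ℂ) : Fin 4 → ℂ :=
  ![(Real.sqrt (3 - t) : ℝ) * z ^ 2, 0, (Real.sqrt (4 - t) : ℝ) * z, 0]

noncomputable def v1t (t : ℝ) (z : ℂ) : Fin 6 → ℂ := vOne (F1t t) z

noncomputable def v2t (t : ℝ) (z : ℂ) : Fin 6 → ℂ := vTwo (F2t t) z

/-! Part 1: hinner basics -/

theorem hi_add_left {m : ℕ} (u v w : Fin m → ℂ) : hinner (u + v) w = hinner u w + hinner v w := by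
  simp [hinner, add_mul, Finset.sum_add_distrib]

theorem hi_add_right {m : ℕ} (u v w : Fin m → ℂ) : hinner u (v + w) = hinner u v + hinner u w := by
  simp [hinner, mul_add, Finset.sum_add_distrib]

theorem hi_smul_left {m : ℕ} (x : ℂ) (u w : Fin m → ℂ) : hinner (x • u) w = x * hinner u w := by
  simp [hinner, Finset.mul_sum, mul_assoc]

theorem hi_smul_right {m : ℕ} (x : ℂ) (u w : Fin m → ℂ) :
    hinner u (x • w) = (starRingEnd ℂ) x * hinner u w := by
  simp only [hinner, Finset.mul_sum, Pi.smul_apply, smul_eq_mul, map_mul]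
  exact Finset.sum_congr rfl fun i _ => by ring

theorem hi_zero_left {m : ℕ} (w : Fin m → ℂ) : hinner 0 w = 0 := by simp [hinner]

theorem hi_zero_right {m : ℕ} (w : Fin m → ℂ) : hinner w 0 = 0 := by simp [hinner]

theorem hi_neg_left {m : ℕ} (u w : Fin m → ℂ) : hinner (-u) w = - hinner u w := by simp [hinner]

theorem hi_neg_right {m : ℕ} (u w : Fin m → ℂ) : hinner u (-w) = - hinner u w := by simp [hinner]

theorem hi_sub_left {m : ℕ} (u v w : Fin m → ℂ) : hinner (u - v) w = hinner u w - hinner v w := by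
  rw [sub_eq_add_neg, hi_add_left, hi_neg_left, sub_eq_add_neg]

theorem hi_sub_right {m : ℕ} (u v w : Fin m → ℂ) : hinner u (v - w) = hinner u v - hinner u w := by
  rw [sub_eq_add_neg, hi_add_right, hi_neg_right, sub_eq_add_neg]

theorem hi_conj {m : ℕ} (u w : Fin m → ℂ) : (starRingEnd ℂ) (hinner u w) = hinner w u := by
  simp [hinner, map_sum, mul_comm]

theorem hi_sum_left {m : ℕ} {ι : Type*} (s : Finset ι) (f : ι → Fin m → ℂ) (w : Fin m → ℂ) :
    hinner (∑ i ∈ s, f i) w = ∑ i ∈ s, hinner (f i) w := by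
  classical
  induction s using Finset.induction_on with
  | empty => simp [hi_zero_left]
  | insert a s ha ih => rw [Finset.sum_insert ha, Finset.sum_insert ha, hi_add_left, ih]

theorem hi_sum_right {m : ℕ} {ι : Type*} (s : Finset ι) (f : ι → Fin m → ℂ) (w : Fin m → ℂ) :
    hinner w (∑ i ∈ s, f i) = ∑ i ∈ s, hinner w (f i) := by
  classical
  induction s using Finset.induction_on with
  | empty => simp [hi_zero_right]
  | insert a s ha ih => rw [Finset.sum_insert ha, Finset.sum_insert ha, hi_add_right, ih]

/-- squared norm -/
noncomputable def nsq {m : ℕ} (u : Fin m → ℂ) : ℝ := ∑ i, Complex.normSq (u i)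

theorem hi_self {m : ℕ} (u : Fin m → ℂ) : hinner u u = (nsq u : ℂ) := by
  simp [hinner, nsq, Complex.mul_conj]

theorem nsq_nonneg {m : ℕ} (u : Fin m → ℂ) : 0 ≤ nsq u :=
  Finset.sum_nonneg fun i _ => Complex.normSq_nonneg _

theorem nsq_eq_zero {m : ℕ} {u : Fin m → ℂ} (h : nsq u = 0) : u = 0 := by
  funext i
  have := (Finset.sum_eq_zero_iff_of_nonneg (fun i _ => Complex.normSq_nonneg (u i))).1 h i
    (Finset.mem_univ i)
  exact Complex.normSq_eq_zero.1 this

theorem nsq_pos {m : ℕ} {u : Fin m → ℂ} (h : u ≠ 0) : 0 < nsq u :=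
  lt_of_le_of_ne (nsq_nonneg u) fun h' => h (nsq_eq_zero h'.symm)

theorem hi_self_eq_zero {m : ℕ} {u : Fin m → ℂ} (h : hinner u u = 0) : u = 0 := by
  rw [hi_self] at h
  exact nsq_eq_zero (by exact_mod_cast h)

/-- equality case of Cauchy-Schwarz -/
theorem hi_cs_eq {m : ℕ} {u w : Fin m → ℂ} (hu : u ≠ 0)
    (h : hinner u u * hinner w w - hinner u w * hinner w u = 0) : ∃ β : ℂ, w = β • u := by
  have hu' : hinner u u ≠ 0 := fun h' => hu (hi_self_eq_zero h')
  refine ⟨hinner w u / hinner u u, ?_⟩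
  rw [← sub_eq_zero]
  apply hi_self_eq_zero
  have e : (starRingEnd ℂ) (hinner w u / hinner u u) = hinner u w / hinner u u := by
    rw [map_div₀, hi_conj, hi_conj]
  simp only [hi_sub_left, hi_sub_right, hi_smul_left, hi_smul_right, e]
  field_simp
  linear_combination h

theorem hi_cs {m : ℕ} (u w : Fin m → ℂ) : Complex.normSq (hinner u w) ≤ nsq u * nsq w := by
  by_cases hw : w = 0
  · subst hw; simp [hi_zero_right, nsq]
  have hp := nsq_pos hw
  have h := nsq_nonneg ((nsq w : ℂ) • u - hinner u w • w)
  have e : ((nsq ((nsq w : ℂ) • u - hinner u w • w) : ℝ) : ℂ)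
      = ((nsq w * (nsq u * nsq w - Complex.normSq (hinner u w)) : ℝ) : ℂ) := by
    rw [← hi_self]
    simp only [hi_sub_left, hi_sub_right, hi_smul_left, hi_smul_right, Complex.conj_ofReal]
    push_cast
    rw [Complex.normSq_eq_conj_mul_self, ← hi_self, ← hi_self, hi_conj]
    ring
  have e' := Complex.ofReal_injective e
  rw [e'] at h
  nlinarith [nonneg_of_mul_nonneg_right h hp]

/-! Part 2: two-variable polynomials -/

open Polynomial in
theorem bi_zero (P : Polynomial (Polynomial ℂ)) (h : ∀ x y, Polynomial.evalEval x y P = 0) :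
    P = 0 := by
  apply Polynomial.eq_zero_of_infinite_isRoot
  refine (Set.infinite_range_of_injective (Polynomial.C_injective (R := ℂ))).mono ?_
  rintro _ ⟨y, rfl⟩
  change Polynomial.eval (Polynomial.C y) P = 0
  apply Polynomial.funext
  intro x
  simpa [Polynomial.evalEval] using h x y

theorem uni_zero (p : Polynomial ℂ) (h : ∀ x : ℝ, p.eval (x : ℂ) = 0) : p = 0 := by
  apply Polynomial.eq_zero_of_infinite_isRoot
  refine (Set.infinite_range_of_injective Complex.ofReal_injective).mono ?_
  rintro _ ⟨y, rfl⟩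
  exact h y

theorem bi_line (P : Polynomial (Polynomial ℂ)) (a b c d : ℂ)
    (h : ∀ x : ℝ, Polynomial.evalEval (a * x + b) (c * x + d) P = 0) (x : ℂ) :
    Polynomial.evalEval (a * x + b) (c * x + d) P = 0 := by
  let q : Polynomial ℂ := Polynomial.eval₂
    (Polynomial.compRingHom (Polynomial.C a * Polynomial.X + Polynomial.C b))
    (Polynomial.C c * Polynomial.X + Polynomial.C d) P
  have hq : ∀ x : ℂ, q.eval x = Polynomial.evalEval (a * x + b) (c * x + d) P := by
    intro x
    change Polynomial.evalRingHom x (Polynomial.eval₂ _ _ P) = _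
    rw [Polynomial.hom_eval₂, ← Polynomial.coe_evalEvalRingHom, Polynomial.evalEvalRingHom_eq]
    congr 1
    · congr 1
      ext <;> simp
    · simp
  have : q = 0 := uni_zero q fun x => by rw [hq, h]
  rw [← hq, this, Polynomial.eval_zero]

theorem bi_diag (P : Polynomial (Polynomial ℂ))
    (h : ∀ z : ℂ, Polynomial.evalEval ((starRingEnd ℂ) z) z P = 0) : P = 0 := by
  have h1 : ∀ (x : ℂ) (y : ℝ), Polynomial.evalEval (1 * x + (-(I * y))) (1 * x + I * y) P = 0 := by
    intro x y
    apply bi_line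
    intro x
    have := h (x + I * y)
    simpa [sub_eq_add_neg] using this
  have h2 : ∀ (x y : ℂ), Polynomial.evalEval ((-I) * y + x) (I * y + x) P = 0 := by
    intro x y
    apply bi_line
    intro y
    have := h1 x y
    convert this using 2 <;> ring
  apply bi_zero
  intro w z
  have := h2 ((z + w) / 2) ((z - w) / (2 * I))
  convert this using 2 <;> · field_simp; ring



noncomputable def sqv {n : ℕ} (a : ℕ → Fin n → ℂ) (z : ℂ) : Fin n → ℂ :=
  ∑ k ∈ Finset.range 5, z ^ k • a k

noncomputable def dsq {n : ℕ} (a : ℕ → Fin n → ℂ) (k : ℕ) : Fin n → ℂ :=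
  ((k : ℂ) + 1) • a (k + 1)

noncomputable def bigU {n : ℕ} (a b : ℕ → Fin n → ℂ) : Fin 4 → ℕ → Fin n → ℂ :=
  ![a, b, dsq a, dsq b]

noncomputable def bigG {n : ℕ} (a b : ℕ → Fin n → ℂ) (z w : ℂ) : Matrix (Fin 4) (Fin 4) ℂ :=
  Matrix.diagonal ![1, 1, 0, 0] +
    Matrix.of fun i j => hinner (sqv (bigU a b i) z) (sqv (bigU a b j) w)

structure Good {n : ℕ} (a b : ℕ → Fin n → ℂ) (c : ℝ) : Prop where
  a0 : a 0 = 0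
  b0 : b 0 = 0
  a5 : ∀ k, 5 ≤ k → a k = 0
  b5 : ∀ k, 5 ≤ k → b k = 0
  A : ∀ z w : ℂ, 1 + hinner (sqv a z) (sqv a w) + hinner (sqv b z) (sqv b w) +
      (hinner (sqv a z) (sqv a w) * hinner (sqv b z) (sqv b w) -
        hinner (sqv a z) (sqv b w) * hinner (sqv b z) (sqv a w)) =
      (1 + z * (starRingEnd ℂ) w) ^ 4
  B : ∀ z w : ℂ, (bigG a b z w).det = c * (1 + z * (starRingEnd ℂ) w) ^ 4

noncomputable def bp {n : ℕ} (u v : ℕ → Fin n → ℂ) : Polynomial (Polynomial ℂ) :=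
  ∑ j ∈ Finset.range 5, ∑ k ∈ Finset.range 5,
    Polynomial.monomial j (Polynomial.monomial k (hinner (u j) (v k)))

theorem bp_eval {n : ℕ} (u v : ℕ → Fin n → ℂ) (z w : ℂ) :
    Polynomial.evalEval ((starRingEnd ℂ) w) z (bp u v) = hinner (sqv u z) (sqv v w) := by
  rw [← Polynomial.coe_evalEvalRingHom]
  simp only [bp, sqv, map_sum]
  rw [hi_sum_left]
  simp only [hi_sum_right, hi_smul_left, hi_smul_right]
  refine Finset.sum_congr rfl fun j _ => Finset.sum_congr rfl fun k _ => ?_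
  rw [Polynomial.coe_evalEvalRingHom, Polynomial.evalEval, Polynomial.eval_monomial,
    Polynomial.eval_mul, Polynomial.eval_monomial, Polynomial.eval_pow, Polynomial.eval_C, map_pow]
  ring

theorem bp_coeff {n : ℕ} (u v : ℕ → Fin n → ℂ) (hu : ∀ k, 5 ≤ k → u k = 0)
    (hv : ∀ k, 5 ≤ k → v k = 0) (j k : ℕ) :
    ((bp u v).coeff j).coeff k = hinner (u j) (v k) := by
  simp only [bp, Polynomial.finsetSum_coeff]
  by_cases hj : j < 5
  · rw [Finset.sum_eq_single j]
    · by_cases hk : k < 5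
      · rw [Finset.sum_eq_single k]
        · simp
        · intro b _ hb
          simp [Polynomial.coeff_monomial, hb]
        · intro h; simp at h; omega
      · rw [hv k (by omega), hi_zero_right]
        apply Finset.sum_eq_zero
        intro b hb
        have : b ≠ k := by simp at hb; omega
        simp [Polynomial.coeff_monomial, this]
    · intro b _ hb
      apply Finset.sum_eq_zero
      intro _ _
      simp [Polynomial.coeff_monomial, hb]
    · intro h; simp at h; omega
  · rw [hu j (by omega), hi_zero_left]
    apply Finset.sum_eq_zero
    intro b hb
    apply Finset.sum_eq_zero
    intro _ _
    have : b ≠ j := by simp at hb; omega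
    simp [Polynomial.coeff_monomial, this]

noncomputable def pw4 : Polynomial (Polynomial ℂ) :=
  ∑ m ∈ Finset.range 5, Polynomial.monomial m (Polynomial.monomial m ((Nat.choose 4 m : ℕ) : ℂ))

theorem pw4_eval (x z : ℂ) : Polynomial.evalEval x z pw4 = (1 + z * x) ^ 4 := by
  rw [← Polynomial.coe_evalEvalRingHom]
  simp only [pw4, map_sum]
  simp only [Polynomial.coe_evalEvalRingHom, Polynomial.evalEval, Polynomial.eval_monomial,
    Polynomial.eval_mul, Polynomial.eval_pow, Polynomial.eval_C]
  simp [Finset.sum_range_succ, Nat.choose]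
  ring

theorem pw4_coeff (j k : ℕ) :
    ((pw4).coeff j).coeff k = if j = k then ((Nat.choose 4 j : ℕ) : ℂ) else 0 := by
  simp only [pw4, Polynomial.finsetSum_coeff]
  by_cases hj : j < 5
  · rw [Finset.sum_eq_single j]
    · simp [Polynomial.coeff_monomial]
    · intro b _ hb
      simp [Polynomial.coeff_monomial, hb]
    · intro h; simp at h; omega
  · rw [Nat.choose_eq_zero_of_lt (by omega)]
    simp only [Nat.cast_zero, ite_self]
    apply Finset.sum_eq_zero
    intro b hb
    have : b ≠ j := by simp at hb; omega
    simp [Polynomial.coeff_monomial, this]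

noncomputable def polyA {n : ℕ} (a b : ℕ → Fin n → ℂ) : Polynomial (Polynomial ℂ) :=
  1 + bp a a + bp b b + (bp a a * bp b b - bp a b * bp b a) - pw4

theorem polyA_eval {n : ℕ} (a b : ℕ → Fin n → ℂ) (z w : ℂ) :
    Polynomial.evalEval ((starRingEnd ℂ) w) z (polyA a b) =
    1 + hinner (sqv a z) (sqv a w) + hinner (sqv b z) (sqv b w) +
      (hinner (sqv a z) (sqv a w) * hinner (sqv b z) (sqv b w) -
        hinner (sqv a z) (sqv b w) * hinner (sqv b z) (sqv a w)) -
      (1 + z * (starRingEnd ℂ) w) ^ 4 := by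
  simp only [← bp_eval, ← pw4_eval]
  simp only [polyA, Polynomial.evalEval_sub, Polynomial.evalEval_add, Polynomial.evalEval_mul, Polynomial.evalEval_one]

noncomputable def bigP {n : ℕ} (a b : ℕ → Fin n → ℂ) :
    Matrix (Fin 4) (Fin 4) (Polynomial (Polynomial ℂ)) :=
  Matrix.diagonal ![1, 1, 0, 0] + Matrix.of fun i j => bp (bigU a b i) (bigU a b j)

noncomputable def polyB {n : ℕ} (a b : ℕ → Fin n → ℂ) (c : ℝ) : Polynomial (Polynomial ℂ) :=
  (bigP a b).det - Polynomial.C (Polynomial.C (c : ℂ)) * pw4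

theorem polyB_eval {n : ℕ} (a b : ℕ → Fin n → ℂ) (c : ℝ) (z w : ℂ) :
    Polynomial.evalEval ((starRingEnd ℂ) w) z (polyB a b c) =
    (bigG a b z w).det - c * (1 + z * (starRingEnd ℂ) w) ^ 4 := by
  rw [← pw4_eval, ← Polynomial.coe_evalEvalRingHom, polyB, map_sub, map_mul, RingHom.map_det]
  congr 2
  · congr 1
    ext i j
    simp only [bigG, bigP, RingHom.mapMatrix_apply, Matrix.map_apply, Matrix.add_apply,
      Matrix.of_apply, map_add, Polynomial.coe_evalEvalRingHom, bp_eval]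
    congr 1
    fin_cases i <;> fin_cases j <;> simp [Matrix.diagonal, Polynomial.evalEval]
  · simp [Polynomial.evalEval]

theorem dsq5 {n : ℕ} {a : ℕ → Fin n → ℂ} (ha : ∀ k, 5 ≤ k → a k = 0) (k : ℕ) (hk : 5 ≤ k) :
    dsq a k = 0 := by
  simp [dsq, ha (k + 1) (by omega)]

/-- from the diagonal to Good -/
theorem good_of_diag {n : ℕ} (a b : ℕ → Fin n → ℂ) (c : ℝ)
    (a0 : a 0 = 0) (b0 : b 0 = 0) (a5 : ∀ k, 5 ≤ k → a k = 0) (b5 : ∀ k, 5 ≤ k → b k = 0)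
    (hA : ∀ z : ℂ, 1 + hinner (sqv a z) (sqv a z) + hinner (sqv b z) (sqv b z) +
      (hinner (sqv a z) (sqv a z) * hinner (sqv b z) (sqv b z) -
        hinner (sqv a z) (sqv b z) * hinner (sqv b z) (sqv a z)) =
      (1 + z * (starRingEnd ℂ) z) ^ 4)
    (hB : ∀ z : ℂ, (bigG a b z z).det = c * (1 + z * (starRingEnd ℂ) z) ^ 4) : Good a b c := by
  have h1 : polyA a b = 0 := bi_diag _ fun z => by rw [polyA_eval, hA z, sub_self]
  have h2 : polyB a b c = 0 := bi_diag _ fun z => by rw [polyB_eval, hB z, sub_self]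
  refine ⟨a0, b0, a5, b5, fun z w => ?_, fun z w => ?_⟩
  · rw [← sub_eq_zero, ← polyA_eval, h1, Polynomial.evalEval_zero]
  · rw [← sub_eq_zero, ← polyB_eval, h2, Polynomial.evalEval_zero]

theorem Good.polyA_zero {n : ℕ} {a b : ℕ → Fin n → ℂ} {c : ℝ} (h : Good a b c) : polyA a b = 0 := by
  apply bi_diag
  intro z
  rw [polyA_eval, h.A, sub_self]

theorem Good.polyB_zero {n : ℕ} {a b : ℕ → Fin n → ℂ} {c : ℝ} (h : Good a b c) :
    polyB a b c = 0 := by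
  apply bi_diag
  intro z
  rw [polyB_eval, h.B, sub_self]

theorem coeff2_mul (p q : Polynomial (Polynomial ℂ)) (m l : ℕ) :
    ((p * q).coeff m).coeff l = ∑ x ∈ Finset.HasAntidiagonal.antidiagonal m, ∑ y ∈ Finset.HasAntidiagonal.antidiagonal l,
      (p.coeff x.1).coeff y.1 * (q.coeff x.2).coeff y.2 := by
  simp only [Polynomial.coeff_mul, Polynomial.finsetSum_coeff]

noncomputable def W2 {n : ℕ} (a b : ℕ → Fin n → ℂ) (m l : ℕ) : ℂ :=
  ∑ x ∈ Finset.HasAntidiagonal.antidiagonal m, ∑ y ∈ Finset.HasAntidiagonal.antidiagonal l,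
    (hinner (a x.1) (a y.1) * hinner (b x.2) (b y.2)
      - hinner (a x.1) (b y.1) * hinner (b x.2) (a y.2))

theorem Good.cofA {n : ℕ} {a b : ℕ → Fin n → ℂ} {c : ℝ} (h : Good a b c) (m l : ℕ) :
    hinner (a (m+1)) (a l) + hinner (b (m+1)) (b l) + W2 a b (m+1) l =
      if m + 1 = l then ((Nat.choose 4 (m+1) : ℕ) : ℂ) else 0 := by
  have h0 : ((polyA a b).coeff (m+1)).coeff l = 0 := by rw [h.polyA_zero]; simp
  simp only [polyA, Polynomial.coeff_sub, Polynomial.coeff_add, coeff2_mul, pw4_coeff,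
    bp_coeff _ _ h.a5 h.a5, bp_coeff _ _ h.a5 h.b5, bp_coeff _ _ h.b5 h.a5, bp_coeff _ _ h.b5 h.b5]
    at h0
  simp only [Polynomial.coeff_one, Nat.succ_ne_zero, if_false, Polynomial.coeff_zero] at h0
  simp only [W2, Finset.sum_sub_distrib]
  linear_combination h0

theorem bp_split {n : ℕ} (u v : ℕ → Fin n → ℂ) (h0 : u 0 = 0) (h5 : ∀ k, 5 ≤ k → u k = 0)
    (hv : ∀ k, 5 ≤ k → v k = 0) :
    ∃ s, bp u v = Polynomial.X * bp (dsq u) v + Polynomial.X ^ 2 * s := by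
  have : Polynomial.X ^ 2 ∣ bp u v - Polynomial.X * bp (dsq u) v := by
    rw [Polynomial.X_pow_dvd_iff]
    intro d hd
    ext k
    have h1 := bp_coeff u v h5 hv
    have h2 := bp_coeff (dsq u) v (dsq5 h5) hv
    interval_cases d
    · simp [h1, h0, hi_zero_left]
    · rw [Polynomial.coeff_sub, Polynomial.coeff_X_mul, Polynomial.coeff_sub, h1, h2]
      simp [dsq]
  obtain ⟨s, hs⟩ := this
  exact ⟨s, by linear_combination hs⟩

def D3 {R : Type*} [CommRing R] (a b c d e f g h i : R) : R :=
  a * (e * i - f * h) - b * (d * i - f * g) + c * (d * h - e * g)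

def D4 {R : Type*} [CommRing R] (p0 p1 p2 p3 : Fin 4 → R) : R :=
  p0 0 * D3 (p1 1) (p1 2) (p1 3) (p2 1) (p2 2) (p2 3) (p3 1) (p3 2) (p3 3)
  - p0 1 * D3 (p1 0) (p1 2) (p1 3) (p2 0) (p2 2) (p2 3) (p3 0) (p3 2) (p3 3)
  + p0 2 * D3 (p1 0) (p1 1) (p1 3) (p2 0) (p2 1) (p2 3) (p3 0) (p3 1) (p3 3)
  - p0 3 * D3 (p1 0) (p1 1) (p1 2) (p2 0) (p2 1) (p2 2) (p3 0) (p3 1) (p3 2)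

theorem det4_formula {R : Type*} [CommRing R] (p : Fin 4 → Fin 4 → R) :
    (Matrix.diagonal ![1, 1, 0, 0] + Matrix.of p).det
      = (p 2 2 * p 3 3 - p 2 3 * p 3 2)
       + D3 (p 1 1) (p 1 2) (p 1 3) (p 2 1) (p 2 2) (p 2 3) (p 3 1) (p 3 2) (p 3 3)
       + D3 (p 0 0) (p 0 2) (p 0 3) (p 2 0) (p 2 2) (p 2 3) (p 3 0) (p 3 2) (p 3 3)
       + D4 (p 0) (p 1) (p 2) (p 3) := by
  have e : (Matrix.diagonal ![1, 1, 0, 0] + Matrix.of p) =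
    !![1 + p 0 0, p 0 1, p 0 2, p 0 3; p 1 0, 1 + p 1 1, p 1 2, p 1 3;
       p 2 0, p 2 1, p 2 2, p 2 3; p 3 0, p 3 1, p 3 2, p 3 3] := by
    ext i j
    fin_cases i <;> fin_cases j <;> simp [Matrix.diagonal]
  rw [e]
  simp only [Matrix.det_succ_row_zero, Fin.sum_univ_succ, Matrix.det_unique]
  simp [Fin.succAbove, Fin.sum_univ_succ, D3, D4]
  ring

theorem det4_split {R : Type*} [CommRing R] (x : R) (p : Fin 4 → Fin 4 → R)
    (h0 : ∀ j, ∃ s, p 0 j = x * p 2 j + x ^ 2 * s)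
    (h1 : ∀ j, ∃ s, p 1 j = x * p 3 j + x ^ 2 * s) :
    ∃ s, (Matrix.diagonal ![1, 1, 0, 0] + Matrix.of p).det
      = (p 2 2 * p 3 3 - p 2 3 * p 3 2) + x ^ 2 * s := by
  choose s hs using h0
  choose r hr using h1
  refine ⟨D3 (r 1) (r 2) (r 3) (p 2 1) (p 2 2) (p 2 3) (p 3 1) (p 3 2) (p 3 3) +
    D3 (s 0) (s 2) (s 3) (p 2 0) (p 2 2) (p 2 3) (p 3 0) (p 3 2) (p 3 3) +
    x ^ 2 * D4 s r (p 2) (p 3), ?_⟩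
  rw [det4_formula]
  simp only [D4, D3, hs, hr]
  ring

theorem Good.cofB {n : ℕ} {a b : ℕ → Fin n → ℂ} {c : ℝ} (h : Good a b c) (m l : ℕ) (hm : m < 2) :
    W2 (dsq a) (dsq b) m l = if m = l then (c : ℂ) * ((Nat.choose 4 m : ℕ) : ℂ) else 0 := by
  have ha := dsq5 h.a5
  have hb := dsq5 h.b5
  have h5 : ∀ j, ∀ k, 5 ≤ k → bigU a b j k = 0 := by
    intro j
    fin_cases j
    · exact h.a5
    · exact h.b5
    · exact ha
    · exact hb
  obtain ⟨s, hs⟩ := det4_split (Polynomial.X : Polynomial (Polynomial ℂ))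
    (fun i j => bp (bigU a b i) (bigU a b j))
    (fun j => bp_split a (bigU a b j) h.a0 h.a5 (h5 j))
    (fun j => bp_split b (bigU a b j) h.b0 h.b5 (h5 j))
  have h0 : ((polyB a b c).coeff m).coeff l = 0 := by rw [h.polyB_zero]; simp
  rw [polyB, bigP, hs] at h0
  have e2 : bigU a b 2 = dsq a := rfl
  have e3 : bigU a b 3 = dsq b := rfl
  simp only [e2, e3, Polynomial.coeff_sub, Polynomial.coeff_add, coeff2_mul, pw4_coeff,
    Polynomial.coeff_C_mul, Polynomial.coeff_X_pow_mul', bp_coeff _ _ ha ha, bp_coeff _ _ ha hb, bp_coeff _ _ hb ha, bp_coeff _ _ hb hb,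
    if_neg (show ¬ 2 ≤ m by omega), Polynomial.coeff_zero] at h0
  simp only [W2, Finset.sum_sub_distrib]
  split_ifs at h0 ⊢
  · linear_combination h0
  · linear_combination h0


/-- inner product of two-vectors -/
noncomputable def wd {n : ℕ} (a b : ℕ → Fin n → ℂ) (i j k l : ℕ) : ℂ :=
  hinner (a i) (a k) * hinner (b j) (b l) - hinner (a i) (b l) * hinner (b j) (a k)

theorem Good.A11 {n : ℕ} {a b : ℕ → Fin n → ℂ} {c : ℝ} (h : Good a b c) :
    hinner (a 1) (a 1) + hinner (b 1) (b 1) = 4 := by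
  have h0 := h.cofA 0 1
  simp [W2, Finset.Nat.antidiagonal_succ, h.a0, h.b0, h.a5, h.b5,
    hi_zero_left, hi_zero_right, Nat.choose] at h0
  try simp only [wd]
  linear_combination h0

theorem Good.A12 {n : ℕ} {a b : ℕ → Fin n → ℂ} {c : ℝ} (h : Good a b c) :
    hinner (a 1) (a 2) + hinner (b 1) (b 2) = 0 := by
  have h0 := h.cofA 0 2
  simp [W2, Finset.Nat.antidiagonal_succ, h.a0, h.b0, h.a5, h.b5,
    hi_zero_left, hi_zero_right, Nat.choose] at h0
  try simp only [wd]
  linear_combination h0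

theorem Good.A13 {n : ℕ} {a b : ℕ → Fin n → ℂ} {c : ℝ} (h : Good a b c) :
    hinner (a 1) (a 3) + hinner (b 1) (b 3) = 0 := by
  have h0 := h.cofA 0 3
  simp [W2, Finset.Nat.antidiagonal_succ, h.a0, h.b0, h.a5, h.b5,
    hi_zero_left, hi_zero_right, Nat.choose] at h0
  try simp only [wd]
  linear_combination h0

theorem Good.A14 {n : ℕ} {a b : ℕ → Fin n → ℂ} {c : ℝ} (h : Good a b c) :
    hinner (a 1) (a 4) + hinner (b 1) (b 4) = 0 := by
  have h0 := h.cofA 0 4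
  simp [W2, Finset.Nat.antidiagonal_succ, h.a0, h.b0, h.a5, h.b5,
    hi_zero_left, hi_zero_right, Nat.choose] at h0
  try simp only [wd]
  linear_combination h0

theorem Good.A22 {n : ℕ} {a b : ℕ → Fin n → ℂ} {c : ℝ} (h : Good a b c) :
    hinner (a 2) (a 2) + hinner (b 2) (b 2) + wd a b 1 1 1 1 = 6 := by
  have h0 := h.cofA 1 2
  simp [W2, Finset.Nat.antidiagonal_succ, h.a0, h.b0, h.a5, h.b5,
    hi_zero_left, hi_zero_right, Nat.choose] at h0
  try simp only [wd]
  linear_combination h0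

theorem Good.A23 {n : ℕ} {a b : ℕ → Fin n → ℂ} {c : ℝ} (h : Good a b c) :
    hinner (a 2) (a 3) + hinner (b 2) (b 3) + wd a b 1 1 1 2 + wd a b 1 1 2 1 = 0 := by
  have h0 := h.cofA 1 3
  simp [W2, Finset.Nat.antidiagonal_succ, h.a0, h.b0, h.a5, h.b5,
    hi_zero_left, hi_zero_right, Nat.choose] at h0
  try simp only [wd]
  linear_combination h0

theorem Good.A24 {n : ℕ} {a b : ℕ → Fin n → ℂ} {c : ℝ} (h : Good a b c) :
    hinner (a 2) (a 4) + hinner (b 2) (b 4) + wd a b 1 1 1 3 + wd a b 1 1 2 2 + wd a b 1 1 3 1 = 0 := by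
  have h0 := h.cofA 1 4
  simp [W2, Finset.Nat.antidiagonal_succ, h.a0, h.b0, h.a5, h.b5,
    hi_zero_left, hi_zero_right, Nat.choose] at h0
  try simp only [wd]
  linear_combination h0

theorem Good.A33 {n : ℕ} {a b : ℕ → Fin n → ℂ} {c : ℝ} (h : Good a b c) :
    hinner (a 3) (a 3) + hinner (b 3) (b 3) + wd a b 1 2 1 2 + wd a b 1 2 2 1 + wd a b 2 1 1 2 + wd a b 2 1 2 1 = 4 := by
  have h0 := h.cofA 2 3
  simp [W2, Finset.Nat.antidiagonal_succ, h.a0, h.b0, h.a5, h.b5,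
    hi_zero_left, hi_zero_right, Nat.choose] at h0
  try simp only [wd]
  linear_combination h0

theorem Good.A34 {n : ℕ} {a b : ℕ → Fin n → ℂ} {c : ℝ} (h : Good a b c) :
    hinner (a 3) (a 4) + hinner (b 3) (b 4) + wd a b 1 2 1 3 + wd a b 1 2 2 2 + wd a b 1 2 3 1 + wd a b 2 1 1 3 + wd a b 2 1 2 2 + wd a b 2 1 3 1 = 0 := by
  have h0 := h.cofA 2 4
  simp [W2, Finset.Nat.antidiagonal_succ, h.a0, h.b0, h.a5, h.b5,
    hi_zero_left, hi_zero_right, Nat.choose] at h0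
  try simp only [wd]
  linear_combination h0

theorem Good.A44 {n : ℕ} {a b : ℕ → Fin n → ℂ} {c : ℝ} (h : Good a b c) :
    hinner (a 4) (a 4) + hinner (b 4) (b 4) + wd a b 1 3 1 3 + wd a b 1 3 2 2 + wd a b 1 3 3 1 + wd a b 2 2 1 3 + wd a b 2 2 2 2 + wd a b 2 2 3 1 + wd a b 3 1 1 3 + wd a b 3 1 2 2 + wd a b 3 1 3 1 = 1 := by
  have h0 := h.cofA 3 4
  simp [W2, Finset.Nat.antidiagonal_succ, h.a0, h.b0, h.a5, h.b5,
    hi_zero_left, hi_zero_right, Nat.choose] at h0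
  try simp only [wd]
  linear_combination h0

theorem Good.A55 {n : ℕ} {a b : ℕ → Fin n → ℂ} {c : ℝ} (h : Good a b c) :
    wd a b 1 4 1 4 + wd a b 1 4 2 3 + wd a b 1 4 3 2 + wd a b 1 4 4 1 + wd a b 2 3 1 4 + wd a b 2 3 2 3 + wd a b 2 3 3 2 + wd a b 2 3 4 1 + wd a b 3 2 1 4 + wd a b 3 2 2 3 + wd a b 3 2 3 2 + wd a b 3 2 4 1 + wd a b 4 1 1 4 + wd a b 4 1 2 3 + wd a b 4 1 3 2 + wd a b 4 1 4 1 = 0 := by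
  have h0 := h.cofA 4 5
  simp [W2, Finset.Nat.antidiagonal_succ, h.a0, h.b0, h.a5, h.b5,
    hi_zero_left, hi_zero_right, Nat.choose] at h0
  try simp only [wd]
  linear_combination h0

theorem Good.A66 {n : ℕ} {a b : ℕ → Fin n → ℂ} {c : ℝ} (h : Good a b c) :
    wd a b 2 4 2 4 + wd a b 2 4 3 3 + wd a b 2 4 4 2 + wd a b 3 3 2 4 + wd a b 3 3 3 3 + wd a b 3 3 4 2 + wd a b 4 2 2 4 + wd a b 4 2 3 3 + wd a b 4 2 4 2 = 0 := by
  have h0 := h.cofA 5 6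
  simp [W2, Finset.Nat.antidiagonal_succ, h.a0, h.b0, h.a5, h.b5,
    hi_zero_left, hi_zero_right, Nat.choose] at h0
  try simp only [wd]
  linear_combination h0

theorem Good.A77 {n : ℕ} {a b : ℕ → Fin n → ℂ} {c : ℝ} (h : Good a b c) :
    wd a b 3 4 3 4 + wd a b 3 4 4 3 + wd a b 4 3 3 4 + wd a b 4 3 4 3 = 0 := by
  have h0 := h.cofA 6 7
  simp [W2, Finset.Nat.antidiagonal_succ, h.a0, h.b0, h.a5, h.b5,
    hi_zero_left, hi_zero_right, Nat.choose] at h0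
  try simp only [wd]
  linear_combination h0

theorem Good.A88 {n : ℕ} {a b : ℕ → Fin n → ℂ} {c : ℝ} (h : Good a b c) :
    wd a b 4 4 4 4 = 0 := by
  have h0 := h.cofA 7 8
  simp [W2, Finset.Nat.antidiagonal_succ, h.a0, h.b0, h.a5, h.b5,
    hi_zero_left, hi_zero_right, Nat.choose] at h0
  try simp only [wd]
  linear_combination h0

theorem Good.B00 {n : ℕ} {a b : ℕ → Fin n → ℂ} {c : ℝ} (h : Good a b c) :
    1 * wd a b 1 1 1 1 = c * 1 := by
  have h0 := h.cofB 0 0 (by norm_num)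
  simp [W2, Finset.Nat.antidiagonal_succ, dsq, h.a5, h.b5, hi_smul_left, hi_smul_right,
    hi_zero_left, hi_zero_right, Nat.choose] at h0
  try simp only [wd]
  linear_combination h0

theorem Good.B01 {n : ℕ} {a b : ℕ → Fin n → ℂ} {c : ℝ} (h : Good a b c) :
    2 * wd a b 1 1 1 2 + 2 * wd a b 1 1 2 1 = 0 := by
  have h0 := h.cofB 0 1 (by norm_num)
  simp [W2, Finset.Nat.antidiagonal_succ, dsq, h.a5, h.b5, hi_smul_left, hi_smul_right,
    hi_zero_left, hi_zero_right, Nat.choose] at h0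
  try simp only [wd]
  linear_combination h0

theorem Good.B02 {n : ℕ} {a b : ℕ → Fin n → ℂ} {c : ℝ} (h : Good a b c) :
    3 * wd a b 1 1 1 3 + 4 * wd a b 1 1 2 2 + 3 * wd a b 1 1 3 1 = 0 := by
  have h0 := h.cofB 0 2 (by norm_num)
  simp [W2, Finset.Nat.antidiagonal_succ, dsq, h.a5, h.b5, hi_smul_left, hi_smul_right,
    hi_zero_left, hi_zero_right, Nat.choose] at h0
  try simp only [wd]
  linear_combination h0

theorem Good.B03 {n : ℕ} {a b : ℕ → Fin n → ℂ} {c : ℝ} (h : Good a b c) :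
    4 * wd a b 1 1 1 4 + 6 * wd a b 1 1 2 3 + 6 * wd a b 1 1 3 2 + 4 * wd a b 1 1 4 1 = 0 := by
  have h0 := h.cofB 0 3 (by norm_num)
  simp [W2, Finset.Nat.antidiagonal_succ, dsq, h.a5, h.b5, hi_smul_left, hi_smul_right,
    hi_zero_left, hi_zero_right, Nat.choose] at h0
  try simp only [wd]
  linear_combination h0

theorem Good.B04 {n : ℕ} {a b : ℕ → Fin n → ℂ} {c : ℝ} (h : Good a b c) :
    8 * wd a b 1 1 2 4 + 9 * wd a b 1 1 3 3 + 8 * wd a b 1 1 4 2 = 0 := by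
  have h0 := h.cofB 0 4 (by norm_num)
  simp [W2, Finset.Nat.antidiagonal_succ, dsq, h.a5, h.b5, hi_smul_left, hi_smul_right,
    hi_zero_left, hi_zero_right, Nat.choose] at h0
  try simp only [wd]
  linear_combination h0

theorem Good.B11 {n : ℕ} {a b : ℕ → Fin n → ℂ} {c : ℝ} (h : Good a b c) :
    4 * wd a b 1 2 1 2 + 4 * wd a b 1 2 2 1 + 4 * wd a b 2 1 1 2 + 4 * wd a b 2 1 2 1 = c * 4 := by
  have h0 := h.cofB 1 1 (by norm_num)
  simp [W2, Finset.Nat.antidiagonal_succ, dsq, h.a5, h.b5, hi_smul_left, hi_smul_right,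
    hi_zero_left, hi_zero_right, Nat.choose] at h0
  try simp only [wd]
  linear_combination h0

theorem Good.B12 {n : ℕ} {a b : ℕ → Fin n → ℂ} {c : ℝ} (h : Good a b c) :
    6 * wd a b 1 2 1 3 + 8 * wd a b 1 2 2 2 + 6 * wd a b 1 2 3 1 + 6 * wd a b 2 1 1 3 + 8 * wd a b 2 1 2 2 + 6 * wd a b 2 1 3 1 = 0 := by
  have h0 := h.cofB 1 2 (by norm_num)
  simp [W2, Finset.Nat.antidiagonal_succ, dsq, h.a5, h.b5, hi_smul_left, hi_smul_right,
    hi_zero_left, hi_zero_right, Nat.choose] at h0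
  try simp only [wd]
  linear_combination h0



def rot {n : ℕ} (p q : ℂ) (a b : ℕ → Fin n → ℂ) : ℕ → Fin n → ℂ := fun k => p • a k + q • b k

structure Uni (p q r s : ℂ) : Prop where
  r1 : p * (starRingEnd ℂ) p + q * (starRingEnd ℂ) q = 1
  r2 : r * (starRingEnd ℂ) r + s * (starRingEnd ℂ) s = 1
  r3 : p * (starRingEnd ℂ) r + q * (starRingEnd ℂ) s = 0
  r4 : r * (starRingEnd ℂ) p + s * (starRingEnd ℂ) q = 0
  c1 : p * (starRingEnd ℂ) p + r * (starRingEnd ℂ) r = 1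
  c2 : q * (starRingEnd ℂ) q + s * (starRingEnd ℂ) s = 1
  c3 : p * (starRingEnd ℂ) q + r * (starRingEnd ℂ) s = 0
  c4 : q * (starRingEnd ℂ) p + s * (starRingEnd ℂ) r = 0

theorem sqv_rot {n : ℕ} (p q : ℂ) (a b : ℕ → Fin n → ℂ) (z : ℂ) :
    sqv (rot p q a b) z = p • sqv a z + q • sqv b z := by
  simp only [sqv, rot, Finset.smul_sum, smul_add, Finset.sum_add_distrib]
  congr 1 <;> refine Finset.sum_congr rfl fun k _ => ?_ <;> rw [smul_comm]

theorem dsq_rot {n : ℕ} (p q : ℂ) (a b : ℕ → Fin n → ℂ) :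
    dsq (rot p q a b) = rot p q (dsq a) (dsq b) := by
  funext k
  simp only [dsq, rot, smul_add]
  rw [smul_comm, smul_comm _ q]

theorem bigG_eq {n : ℕ} (a b : ℕ → Fin n → ℂ) (z w : ℂ) : bigG a b z w =
    !![1 + hinner (sqv a z) (sqv a w), hinner (sqv a z) (sqv b w), hinner (sqv a z) (sqv (dsq a) w), hinner (sqv a z) (sqv (dsq b) w);
      hinner (sqv b z) (sqv a w), 1 + hinner (sqv b z) (sqv b w), hinner (sqv b z) (sqv (dsq a) w), hinner (sqv b z) (sqv (dsq b) w);
      hinner (sqv (dsq a) z) (sqv a w), hinner (sqv (dsq a) z) (sqv b w), hinner (sqv (dsq a) z) (sqv (dsq a) w), hinner (sqv (dsq a) z) (sqv (dsq b) w);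
      hinner (sqv (dsq b) z) (sqv a w), hinner (sqv (dsq b) z) (sqv b w), hinner (sqv (dsq b) z) (sqv (dsq a) w), hinner (sqv (dsq b) z) (sqv (dsq b) w)] := by
  ext i j
  fin_cases i <;> fin_cases j <;> simp [bigG, bigU, Matrix.diagonal]

theorem Good.rot {n : ℕ} {a b : ℕ → Fin n → ℂ} {c : ℝ} (h : Good a b c) {p q r s : ℂ}
    (u : Uni p q r s) : Good (rot p q a b) (_root_.rot r s a b) c := by
  refine ⟨by simp [_root_.rot, h.a0, h.b0], by simp [_root_.rot, h.a0, h.b0],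
    fun k hk => by simp [_root_.rot, h.a5 k hk, h.b5 k hk],
    fun k hk => by simp [_root_.rot, h.a5 k hk, h.b5 k hk], fun z w => ?_, fun z w => ?_⟩
  · rw [← h.A z w]
    simp only [sqv_rot, hi_add_left, hi_add_right, hi_smul_left, hi_smul_right]
    obtain ⟨r1, r2, r3, r4, c1, c2, c3, c4⟩ := u
    generalize (starRingEnd ℂ) p = P at *
    generalize (starRingEnd ℂ) q = Q at *
    generalize (starRingEnd ℂ) r = R at *
    generalize (starRingEnd ℂ) s = S at *
    generalize hinner (sqv a z) (sqv a w) = x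
    generalize hinner (sqv a z) (sqv b w) = y
    generalize hinner (sqv b z) (sqv a w) = y'
    generalize hinner (sqv b z) (sqv b w) = x'
    have hd : (p * s - q * r) * (P * S - Q * R) = 1 := by
      linear_combination r2 * (p * P + q * Q) - r4 * (p * R + q * S) + r1
    linear_combination c1 * x + c2 * x' + c3 * y + c4 * y' + hd * (x * x' - y * y')
  · have e : bigG (_root_.rot p q a b) (_root_.rot r s a b) z w =
        !![p, q, 0, 0; r, s, 0, 0; 0, 0, p, q; 0, 0, r, s] * bigG a b z w *
        !![(starRingEnd ℂ) p, (starRingEnd ℂ) r, 0, 0; (starRingEnd ℂ) q, (starRingEnd ℂ) s, 0, 0;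
           0, 0, (starRingEnd ℂ) p, (starRingEnd ℂ) r; 0, 0, (starRingEnd ℂ) q, (starRingEnd ℂ) s] := by
      obtain ⟨r1, r2, r3, r4, c1, c2, c3, c4⟩ := u
      rw [bigG_eq, bigG_eq]
      ext i j
      fin_cases i <;> fin_cases j <;>
        simp [Matrix.mul_apply, Fin.sum_univ_four, sqv_rot, dsq_rot,
          hi_add_left, hi_add_right, hi_smul_left, hi_smul_right] <;>
        first
        | ring1
        | linear_combination -r1
        | linear_combination -r2
        | linear_combination -r3
        | linear_combination -r4
    have d1 : Matrix.det !![p, q, 0, 0; r, s, 0, 0; 0, 0, p, q; 0, 0, r, s] = (p * s - q * r) ^ 2 := by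
      simp only [Matrix.det_succ_row_zero, Fin.sum_univ_succ, Matrix.det_unique]
      simp [Fin.succAbove, Fin.sum_univ_succ]
      ring
    have d2 : Matrix.det !![(starRingEnd ℂ) p, (starRingEnd ℂ) r, 0, 0; (starRingEnd ℂ) q, (starRingEnd ℂ) s, 0, 0;
           0, 0, (starRingEnd ℂ) p, (starRingEnd ℂ) r; 0, 0, (starRingEnd ℂ) q, (starRingEnd ℂ) s] =
        ((starRingEnd ℂ) p * (starRingEnd ℂ) s - (starRingEnd ℂ) q * (starRingEnd ℂ) r) ^ 2 := by
      simp only [Matrix.det_succ_row_zero, Fin.sum_univ_succ, Matrix.det_unique]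
      simp [Fin.succAbove, Fin.sum_univ_succ]
      ring
    rw [e, Matrix.det_mul, Matrix.det_mul, d1, d2, h.B]
    obtain ⟨r1, r2, r3, r4, c1, c2, c3, c4⟩ := u
    generalize (starRingEnd ℂ) p = P at *
    generalize (starRingEnd ℂ) q = Q at *
    generalize (starRingEnd ℂ) r = R at *
    generalize (starRingEnd ℂ) s = S at *
    have hd : (p * s - q * r) * (P * S - Q * R) = 1 := by
      linear_combination r2 * (p * P + q * Q) - r4 * (p * R + q * S) + r1
    linear_combination (c * (1 + z * (starRingEnd ℂ) w) ^ 4) * ((p * s - q * r) * (P * S - Q * R) + 1) * hd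

structure Model {n : ℕ} (a b : ℕ → Fin n → ℂ) (t : ℝ) : Prop where
  aa : ∀ z w : ℂ, hinner (sqv a z) (sqv a w) =
    (t - 2) ^ 2 * (z * (starRingEnd ℂ) w) ^ 3 + t * (z * (starRingEnd ℂ) w)
      + (t ^ 2 - 3 * t + 3) * (z * (starRingEnd ℂ) w) ^ 2
  bb : ∀ z w : ℂ, hinner (sqv b z) (sqv b w) =
    (3 - t) * (z * (starRingEnd ℂ) w) ^ 2 + (4 - t) * (z * (starRingEnd ℂ) w)
  ab : ∀ z w : ℂ, hinner (sqv a z) (sqv b w) =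
    ((|t - 2| * Real.sqrt (3 - t) : ℝ) : ℂ) *
      (z ^ 3 * (starRingEnd ℂ) w ^ 2 + z ^ 2 * (starRingEnd ℂ) w)

def CoreConcl {n : ℕ} (a b : ℕ → Fin n → ℂ) (c : ℝ) : Prop :=
  ∃ t : ℝ, 0 < t ∧ t ≤ 3 ∧ c = 4 * t - t ^ 2 ∧ ∃ p q r s : ℂ, Uni p q r s ∧
    Model (rot p q a b) (rot r s a b) t

theorem rot_rot {n : ℕ} (a b : ℕ → Fin n → ℂ) (p q p' q' r' s' : ℂ) :
    rot p q (rot p' q' a b) (rot r' s' a b) = rot (p * p' + q * r') (p * q' + q * s') a b := by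
  funext k
  simp only [rot]
  module

theorem Uni.comp {p q r s p' q' r' s' : ℂ} (u : Uni p q r s) (v : Uni p' q' r' s') :
    Uni (p * p' + q * r') (p * q' + q * s') (r * p' + s * r') (r * q' + s * s') := by
  obtain ⟨r1, r2, r3, r4, c1, c2, c3, c4⟩ := u
  obtain ⟨r1', r2', r3', r4', c1', c2', c3', c4'⟩ := v
  constructor <;> simp only [map_add, map_mul]
  all_goals
    generalize (starRingEnd ℂ) p = P at *
    generalize (starRingEnd ℂ) q = Q at *
    generalize (starRingEnd ℂ) r = R at *
    generalize (starRingEnd ℂ) s = S at *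
    generalize (starRingEnd ℂ) p' = P' at *
    generalize (starRingEnd ℂ) q' = Q' at *
    generalize (starRingEnd ℂ) r' = R' at *
    generalize (starRingEnd ℂ) s' = S' at *
  · linear_combination p * P * r1' + q * Q * r2' + p * Q * r3' + q * P * r4' + r1
  · linear_combination r * R * r1' + s * S * r2' + r * S * r3' + s * R * r4' + r2
  · linear_combination p * R * r1' + q * S * r2' + p * S * r3' + q * R * r4' + r3
  · linear_combination r * P * r1' + s * Q * r2' + r * Q * r3' + s * P * r4' + r4
  · linear_combination p' * P' * c1 + r' * R' * c2 + p' * R' * c3 + r' * P' * c4 + c1'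
  · linear_combination q' * Q' * c1 + s' * S' * c2 + q' * S' * c3 + s' * Q' * c4 + c2'
  · linear_combination p' * Q' * c1 + r' * S' * c2 + p' * S' * c3 + r' * Q' * c4 + c3'
  · linear_combination q' * P' * c1 + s' * R' * c2 + q' * R' * c3 + s' * P' * c4 + c4'

theorem CoreConcl.of_rot {n : ℕ} {a b : ℕ → Fin n → ℂ} {c : ℝ} {p q r s : ℂ} (u : Uni p q r s)
    (h : CoreConcl (rot p q a b) (rot r s a b) c) : CoreConcl a b c := by
  obtain ⟨t, h0, h3, hc, p', q', r', s', u', hm⟩ := h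
  refine ⟨t, h0, h3, hc, _, _, _, _, u'.comp u, ?_⟩
  rw [rot_rot, rot_rot] at hm
  exact hm

theorem uni_one : Uni 1 0 0 1 := by constructor <;> simp

theorem uni_phase (e : ℂ) (he : e * (starRingEnd ℂ) e = 1) : Uni 1 0 0 e := by
  constructor <;> simp [he]

/-- kill a combination -/
theorem uni_kill (x y : ℂ) : ∃ p q r s : ℂ, Uni p q r s ∧ r * x + s * y = 0 := by
  by_cases hx : x = 0 ∧ y = 0
  · exact ⟨1, 0, 0, 1, uni_one, by simp [hx.1, hx.2]⟩
  have hN : 0 < normSq x + normSq y := by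
    by_contra hn
    have h1 := normSq_nonneg x
    have h2 := normSq_nonneg y
    exact hx ⟨normSq_eq_zero.1 (by linarith), normSq_eq_zero.1 (by linarith)⟩
  set N : ℝ := Real.sqrt (normSq x + normSq y) with hNd
  have hNN : (N : ℂ) * N = x * (starRingEnd ℂ) x + y * (starRingEnd ℂ) y := by
    rw [mul_conj, mul_conj]
    exact_mod_cast Real.mul_self_sqrt hN.le
  have hN0 : (N : ℂ) ≠ 0 := by
    exact_mod_cast (Real.sqrt_pos.2 hN).ne'
  refine ⟨(starRingEnd ℂ) x / N, (starRingEnd ℂ) y / N, -y / N, x / N, ?_, by field_simp; ring⟩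
  constructor <;> simp only [map_div₀, map_neg, conj_ofReal, conj_conj] <;> field_simp <;>
    first | ring1 | linear_combination -hNN


theorem hi0 {m : ℕ} {u w : Fin m → ℂ} (h : hinner u w = 0) : hinner w u = 0 := by
  rw [← hi_conj, h, map_zero]

theorem ab4 {n : ℕ} (u : ℕ → Fin n → ℂ) (z : ℂ) :
    sqv u z = u 0 + z • u 1 + z ^ 2 • u 2 + z ^ 3 • u 3 + z ^ 4 • u 4 := by
  simp [sqv, Finset.sum_range_succ]

/-- explicit B identity at w = 1 -/
theorem Good.Be {n : ℕ} {a b : ℕ → Fin n → ℂ} {c : ℝ} (h : Good a b c) (z : ℂ)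
    (p : Fin 4 → Fin 4 → ℂ)
    (hp : ∀ i j, hinner (sqv (bigU a b i) z) (sqv (bigU a b j) 1) = p i j) :
    (p 2 2 * p 3 3 - p 2 3 * p 3 2)
       + D3 (p 1 1) (p 1 2) (p 1 3) (p 2 1) (p 2 2) (p 2 3) (p 3 1) (p 3 2) (p 3 3)
       + D3 (p 0 0) (p 0 2) (p 0 3) (p 2 0) (p 2 2) (p 2 3) (p 3 0) (p 3 2) (p 3 3)
       + D4 (p 0) (p 1) (p 2) (p 3) = c * (1 + z) ^ 4 := by
  rw [← det4_formula]
  have := h.B z 1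
  rw [bigG] at this
  simp only [hp] at this
  rw [this]
  simp

theorem caseIII_core {n : ℕ} {a b : ℕ → Fin n → ℂ} {c : ℝ} (h : Good a b c)
    (a3 : a 3 = 0) (a4 : a 4 = 0) (b3 : b 3 = 0) (b4 : b 4 = 0)
    (h1 : hinner (b 1) (a 2) = 0) (h2 : hinner (b 1) (b 2) = 0) : CoreConcl a b c := by
  have A11 := h.A11
  have A12 := h.A12
  have A22 := h.A22
  have A33 := h.A33
  have A44 := h.A44
  have B00 := h.B00
  have B11 := h.B11
  simp only [wd, a3, a4, b3, b4, hi_zero_left, hi_zero_right] at A22 A33 A44 B00 B11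
  have hc4 : c = 4 := by
    have : (c : ℂ) = 4 := by linear_combination A33 - B11 / 4
    exact_mod_cast this
  subst hc4
  have key : ∀ u v : Fin n → ℂ, ∀ r : ℝ, hinner u u + hinner v v = 2 * r →
      hinner u u * hinner v v - hinner u v * hinner v u = r * r →
      hinner u u = r ∧ hinner v v = r ∧ hinner u v = 0 := by
    intro u v r e1 e2
    have e3 : hinner u v * hinner v u = normSq (hinner u v) := by
      rw [← hi_conj u v, mul_conj]
    rw [e3] at e2
    rw [hi_self, hi_self] at e1 e2
    rw [hi_self, hi_self]
    norm_cast at e1 e2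
    have q := normSq_nonneg (hinner u v)
    have q1 : nsq u = r := by
      have : (nsq u - r) ^ 2 = 0 := by
        have h1 : nsq v = 2 * r - nsq u := by linarith
        rw [h1] at e2
        nlinarith [sq_nonneg (nsq u - r)]
      have := pow_eq_zero_iff (two_ne_zero) |>.1 this
      linarith
    have q2 : nsq v = r := by linarith
    have q3 : normSq (hinner u v) = 0 := by rw [q1, q2] at e2; linarith
    exact ⟨by rw [q1], by rw [q2], normSq_eq_zero.1 q3⟩
  obtain ⟨x1, y1, w1⟩ := key (a 1) (b 1) 2 (by push_cast; linear_combination A11)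
    (by push_cast at *; linear_combination B00)
  obtain ⟨x2, y2, w2⟩ := key (a 2) (b 2) 1 (by push_cast at *; linear_combination A22 - B00)
    (by push_cast; linear_combination A44)
  have h3 : hinner (a 1) (a 2) = 0 := by linear_combination A12 - h2
  have h1' := hi0 h1
  have h2' := hi0 h2
  have h3' := hi0 h3
  have w1' := hi0 w1
  have w2' := hi0 w2
  have hq : hinner (a 1) (b 2) = 0 := by
    have e : ∀ z : ℂ, _ := fun z => h.Be z
      ![![2 * z + z ^ 2, hinner (a 1) (b 2) * z, 2 * z + 2 * z ^ 2, 2 * hinner (a 1) (b 2) * z],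
        ![hinner (b 2) (a 1) * z ^ 2, 2 * z + z ^ 2, hinner (b 2) (a 1) * z ^ 2, 2 * z + 2 * z ^ 2],
        ![2 + 2 * z, hinner (a 1) (b 2), 2 + 4 * z, 2 * hinner (a 1) (b 2)],
        ![2 * hinner (b 2) (a 1) * z, 2 + 2 * z, 2 * hinner (b 2) (a 1) * z, 2 + 4 * z]]
      (by
        intro i j
        fin_cases i <;> fin_cases j <;>
        simp [-mul_eq_mul_right_iff, -mul_eq_mul_left_iff, -mul_eq_zero, bigU, ab4, dsq, h.a0, h.b0, a3, a4, b3, b4, h.a5, h.b5, hi_add_left, hi_add_right,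
          hi_smul_left, hi_smul_right, hi_zero_left, hi_zero_right, x1, y1, w1, x2, y2, w2,
          h1, h2, h3, h1', h2', h3', w1', w2'] <;> ring)
    simp [D3, D4] at e
    have : hinner (a 1) (b 2) * hinner (b 2) (a 1) = 0 := by
      linear_combination (-1/2) * ((e 2 - 4 * e 1 + 6 * e 0 - 4 * e (-1) + e (-2))/24)
    rw [← hi_conj (a 1) (b 2), mul_conj] at this
    exact normSq_eq_zero.1 (by exact_mod_cast this)
  have hq' := hi0 hq
  refine ⟨2, by norm_num, by norm_num, by norm_num, 1, 0, 0, 1, uni_one, ?_⟩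
  have e1 : rot 1 0 a b = a := by funext k; simp [rot]
  have e2 : rot 0 1 a b = b := by funext k; simp [rot]
  rw [e1, e2]
  constructor <;> intro z w <;>
    simp [ab4, h.a0, h.b0, a3, a4, b3, b4, hi_add_left, hi_add_right,
          hi_smul_left, hi_smul_right, hi_zero_left, hi_zero_right, x1, y1, w1, x2, y2, w2,
          h1, h2, h3, h1', h2', h3', w1', w2', hq, hq'] <;> ring

theorem caseIII {n : ℕ} {a b : ℕ → Fin n → ℂ} {c : ℝ} (h : Good a b c)
    (a3 : a 3 = 0) (a4 : a 4 = 0) (b3 : b 3 = 0) (b4 : b 4 = 0) : CoreConcl a b c := by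
  have A12 := h.A12
  have B02 := h.B02
  simp only [wd, a3, a4, b3, b4, hi_zero_left, hi_zero_right] at B02
  have : ∃ p q r s : ℂ, Uni p q r s ∧ r * hinner (a 1) (a 2) + s * hinner (b 1) (a 2) = 0 ∧
      r * hinner (a 1) (b 2) + s * hinner (b 1) (b 2) = 0 := by
    by_cases h0 : hinner (b 1) (a 2) = 0
    · have h1 : hinner (b 1) (b 2) = 0 := by
        have : hinner (b 1) (b 2) * hinner (b 1) (b 2) = 0 := by
          rw [h0] at B02
          linear_combination hinner (b 1) (b 2) * A12 - B02 / 4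
        exact mul_self_eq_zero.1 this
      have h2 : hinner (a 1) (a 2) = 0 := by linear_combination A12 - h1
      exact ⟨1, 0, 0, 1, uni_one, by simp [h0], by simp [h1]⟩
    · obtain ⟨p, q, r, s, u, hk⟩ := uni_kill (hinner (a 1) (a 2)) (hinner (b 1) (a 2))
      refine ⟨p, q, r, s, u, hk, ?_⟩
      apply mul_left_cancel₀ h0
      linear_combination hinner (b 1) (b 2) * hk - r * B02 / 4
  obtain ⟨p, q, r, s, u, k1, k2⟩ := this
  apply CoreConcl.of_rot u
  apply caseIII_core (h.rot u)
  · simp [rot, a3, b3]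
  · simp [rot, a4, b4]
  · simp [rot, a3, b3]
  · simp [rot, a4, b4]
  · simp only [rot, hi_add_left, hi_add_right, hi_smul_left, hi_smul_right]
    linear_combination (starRingEnd ℂ) p * k1 + (starRingEnd ℂ) q * k2
  · simp only [rot, hi_add_left, hi_add_right, hi_smul_left, hi_smul_right]
    linear_combination (starRingEnd ℂ) r * k1 + (starRingEnd ℂ) s * k2


theorem hi_nsq {m : ℕ} (u w : Fin m → ℂ) : hinner u w * hinner w u = (normSq (hinner u w) : ℂ) := by
  rw [← hi_conj u w, mul_conj]

theorem Good.LB1 {n : ℕ} {a b : ℕ → Fin n → ℂ} {c : ℝ} (h : Good a b c) (κ : ℂ)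
    (b2 : b 2 = 0) (b3 : b 3 = 0) (b4 : b 4 = 0) (a4 : a 4 = κ • b 1)
    (h1 : hinner (a 1) (a 2) = 0) (h2 : hinner (a 1) (a 3) = 0) (h3 : hinner (a 2) (a 3) = 0)
    (h4 : hinner (a 2) (b 1) = 0) (hyz : hinner (a 3) (b 1) * hinner (b 1) (a 1) = 0) :
    nsq (a 1) * nsq (a 3) * nsq (b 1) - nsq (a 3) * normSq (hinner (a 1) (b 1))
      - nsq (a 1) * normSq (hinner (a 3) (b 1)) = c ∧
    nsq (a 2) * (nsq (a 3) * nsq (b 1) - normSq (hinner (a 3) (b 1))) = c := by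
  have h1' := hi0 h1
  have h2' := hi0 h2
  have h3' := hi0 h3
  have h4' := hi0 h4
  have n1 := hi_nsq (a 1) (b 1)
  have n3 := hi_nsq (a 3) (b 1)
  have g1 := hi_self (a 1)
  have g2 := hi_self (a 2)
  have g3 := hi_self (a 3)
  have g4 := hi_self (b 1)
  generalize hy1 : hinner (a 1) (b 1) = y1 at *
  generalize hz1 : hinner (b 1) (a 1) = z1 at *
  generalize hy3 : hinner (a 3) (b 1) = y3 at *
  generalize hz3 : hinner (b 1) (a 3) = z3 at *
  generalize hk : (starRingEnd ℂ) κ = K at *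
  generalize hA1 : ((nsq (a 1) : ℝ) : ℂ) = A1 at *
  generalize hA2 : ((nsq (a 2) : ℝ) : ℂ) = A2 at *
  generalize hA3 : ((nsq (a 3) : ℝ) : ℂ) = A3 at *
  generalize hB1 : ((nsq (b 1) : ℝ) : ℂ) = B1 at *
  have c2 : (starRingEnd ℂ) 2 = 2 := map_ofNat _ 2
  have c3 : (starRingEnd ℂ) 3 = 3 := map_ofNat _ 3
  have e : ∀ z : ℂ, _ := fun z => h.Be z
      ![![A1 * z + A2 * z ^ 2 + A3 * z ^ 3 + κ * z ^ 4 * (z1 + z3 + K * B1) + K * (y1 * z + y3 * z ^ 3),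
          y1 * z + y3 * z ^ 3 + κ * z ^ 4 * B1,
          A1 * z + 2 * A2 * z ^ 2 + 3 * A3 * z ^ 3 + κ * z ^ 4 * (z1 + 3 * z3 + 4 * K * B1) + 4 * K * (y1 * z + y3 * z ^ 3),
          y1 * z + y3 * z ^ 3 + κ * z ^ 4 * B1],
        ![z * (z1 + z3 + K * B1), B1 * z, z * (z1 + 3 * z3 + 4 * K * B1), B1 * z],
        ![A1 + 2 * A2 * z + 3 * A3 * z ^ 2 + 4 * κ * z ^ 3 * (z1 + z3 + K * B1) + K * (y1 + 3 * y3 * z ^ 2),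
          y1 + 3 * y3 * z ^ 2 + 4 * κ * z ^ 3 * B1,
          A1 + 4 * A2 * z + 9 * A3 * z ^ 2 + 4 * κ * z ^ 3 * (z1 + 3 * z3 + 4 * K * B1) + 4 * K * (y1 + 3 * y3 * z ^ 2),
          y1 + 3 * y3 * z ^ 2 + 4 * κ * z ^ 3 * B1],
        ![(z1 + z3 + K * B1), B1, (z1 + 3 * z3 + 4 * K * B1), B1]]
      (by
        intro i j
        fin_cases i <;> fin_cases j <;>
        simp [c2, c3, -mul_eq_mul_right_iff, -mul_eq_mul_left_iff, -mul_eq_zero, bigU, ab4, dsq, h.a0, h.b0, b2, a4, b3, b4, h.a5, h.b5, hi_add_left, hi_add_right,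
          hi_smul_left, hi_smul_right, hi_zero_left, hi_zero_right,
          h1, h2, h3, h4, h1', h2', h3', h4', g1, g2, g3, g4, hy1, hz1, hy3, hz3, hk] <;> ring)
  simp [D3, D4] at e
  constructor
  · have : A1 * A3 * B1 - A3 * (y1 * z1) - A1 * (y3 * z3) = c := by
      linear_combination (e 2 - 2 * e 1 + 2 * e (-1) - e (-2))/48
    rw [n1, n3, ← hA1, ← hA3, ← hB1] at this
    exact_mod_cast this
  · have : A2 * (A3 * B1 - y3 * z3) = c := by
      linear_combination (e 2 - 4 * e 1 + 6 * e 0 - 4 * e (-1) + e (-2))/24 - A2 * hyz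
    rw [n3, ← hA2, ← hA3, ← hB1] at this
    exact_mod_cast this

theorem Good.LB2 {n : ℕ} {a b : ℕ → Fin n → ℂ} {c : ℝ} (h : Good a b c) (β : ℂ)
    (b2 : b 2 = β • a 3) (b3 : b 3 = 0) (b4 : b 4 = 0) (a4 : a 4 = 0)
    (h1 : hinner (a 1) (a 2) = 0) (h2 : hinner (a 1) (a 3) = 0) (h3 : hinner (a 2) (a 3) = 0)
    (h4 : hinner (a 1) (b 1) = 0) (h5 : hinner (a 3) (b 1) = 0) :
    normSq β * nsq (a 3) * (nsq (a 2) * nsq (b 1) - normSq (hinner (a 2) (b 1))) +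
      nsq (a 1) * nsq (a 3) * (nsq (b 1) - 2 * (β * hinner (a 2) (b 1)).re + normSq β * nsq (a 2)) = c ∧
    nsq (a 3) * (nsq (a 2) * nsq (b 1) - normSq (hinner (a 2) (b 1))) * (1 + normSq β * nsq (a 1)) = c := by
  have h1' := hi0 h1
  have h2' := hi0 h2
  have h3' := hi0 h3
  have h4' := hi0 h4
  have h5' := hi0 h5
  have n2 := hi_nsq (a 2) (b 1)
  have nb := mul_conj β
  have hre : β * hinner (a 2) (b 1) + (starRingEnd ℂ) β * hinner (b 1) (a 2)
      = 2 * ((β * hinner (a 2) (b 1)).re : ℂ) := by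
    rw [← hi_conj (a 2) (b 1), ← map_mul, add_conj]; push_cast; ring
  have g1 := hi_self (a 1)
  have g2 := hi_self (a 2)
  have g3 := hi_self (a 3)
  have g4 := hi_self (b 1)
  generalize hy : hinner (a 2) (b 1) = y at *
  generalize hz : hinner (b 1) (a 2) = y' at *
  generalize hk : (starRingEnd ℂ) β = s at *
  generalize hA1 : ((nsq (a 1) : ℝ) : ℂ) = A1 at *
  generalize hA2 : ((nsq (a 2) : ℝ) : ℂ) = A2 at *
  generalize hA3 : ((nsq (a 3) : ℝ) : ℂ) = A3 at *
  generalize hB1 : ((nsq (b 1) : ℝ) : ℂ) = B1 at *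
  have c2 : (starRingEnd ℂ) 2 = 2 := map_ofNat _ 2
  have c3 : (starRingEnd ℂ) 3 = 3 := map_ofNat _ 3
  have e : ∀ z : ℂ, _ := fun z => h.Be z
      ![![A1 * z + A2 * z ^ 2 + A3 * z ^ 3, y * z ^ 2 + s * A3 * z ^ 3,
          A1 * z + 2 * A2 * z ^ 2 + 3 * A3 * z ^ 3, y * z ^ 2 + 2 * s * A3 * z ^ 3],
        ![y' * z + β * A3 * z ^ 2, B1 * z + β * s * A3 * z ^ 2,
          2 * y' * z + 3 * β * A3 * z ^ 2, B1 * z + 2 * β * s * A3 * z ^ 2],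
        ![A1 + 2 * A2 * z + 3 * A3 * z ^ 2, 2 * y * z + 3 * s * A3 * z ^ 2,
          A1 + 4 * A2 * z + 9 * A3 * z ^ 2, 2 * y * z + 6 * s * A3 * z ^ 2],
        ![y' + 2 * β * A3 * z, B1 + 2 * β * s * A3 * z,
          2 * y' + 6 * β * A3 * z, B1 + 4 * β * s * A3 * z]]
      (by
        intro i j
        fin_cases i <;> fin_cases j <;>
        simp [c2, c3, -mul_eq_mul_right_iff, -mul_eq_mul_left_iff, -mul_eq_zero, bigU, ab4, dsq, h.a0, h.b0, b2, a4, b3, b4, h.a5, h.b5, hi_add_left, hi_add_right,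
          hi_smul_left, hi_smul_right, hi_zero_left, hi_zero_right,
          h1, h2, h3, h4, h5, h1', h2', h3', h4', h5', g1, g2, g3, g4, hy, hz, hk] <;> ring)
  simp [D3, D4] at e
  constructor
  · have : (β * s) * A3 * (A2 * B1 - y * y') + A1 * A3 * (B1 - (β * y + s * y') + β * s * A2) = c := by
      linear_combination (e 2 - 2 * e 1 + 2 * e (-1) - e (-2))/48
    rw [n2, nb, hre, ← hA1, ← hA3, ← hB1, ← hA2] at this
    exact_mod_cast this
  · have : A3 * (A2 * B1 - y * y') * (1 + β * s * A1) = c := by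
      linear_combination (e 2 - 4 * e 1 + 6 * e 0 - 4 * e (-1) + e (-2))/24
    rw [n2, nb, ← hA1, ← hA2, ← hA3, ← hB1] at this
    exact_mod_cast this


theorem caseII_alg (T S c k r A2 Y e : ℝ) (hc : 0 < c) (hT : 0 ≤ T) (hr : 0 ≤ r) (hk : 0 < k)
    (h1 : T + S = 4) (h2 : T * S = c) (h3 : A2 + r * k + T * S = 6) (h4 : k = 4 - c)
    (h5 : T * r * k + (A2 * S - Y) = c)
    (h6 : k * (A2 * r - 2 * e + S) = 1)
    (h7 : r * k * (A2 * S - Y) + T * k * (S - 2 * e + r * A2) = c)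
    (h8 : k * (A2 * S - Y) * (1 + r * T) = c) :
    0 < T ∧ T ≤ 3 ∧ c = 4 * T - T ^ 2 ∧ k = (T - 2) ^ 2 ∧ r * k = 3 - T ∧ A2 = T ^ 2 - 3 * T + 3 ∧
      Y = (3 - T) * (T - 2) ^ 2 ∧ e = 3 - T := by
  have hT0 : 0 < T := by
    rcases hT.lt_or_eq with h | h
    · exact h
    · rw [← h] at h2; linarith
  have hS : S = 4 - T := by linarith
  subst hS
  have hcT : c = 4 * T - T ^ 2 := by rw [← h2]; ring
  have hkT : k = (T - 2) ^ 2 := by rw [h4, hcT]; ring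
  obtain ⟨D, hD⟩ : ∃ D, D = A2 * (4 - T) - Y := ⟨_, rfl⟩
  rw [← hD] at h5 h7 h8
  have h7' : r * k * D + T = c := by linear_combination h7 - T * h6
  have h8' : (D - T) * (D - (4 - T)) = 0 := by
    linear_combination (-1 : ℝ) * h8 + D * h5 + D * h4 + h2
  have hDT : D = T := by
    rcases mul_eq_zero.1 h8' with h | h
    · linarith
    · have hDS : D = 4 - T := by linarith
      rw [hDS] at h5 h7'
      have e1 : (4 - T - T) * (c - 4) = 0 := by
        have : (4 - T) * (T * r * k + (4 - T)) + T * T - (4 - T) * (4 - T) = T * c := by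
          linear_combination T * h7'
        rw [h5] at this
        rw [← h2] at this ⊢
        linear_combination this
      rcases mul_eq_zero.1 e1 with h' | h'
      · linarith
      · linarith
  have hrk : r * k = 3 - T := by
    apply mul_left_cancel₀ hT0.ne'
    linear_combination h5 - hDT - h2
  have hA2 : A2 = T ^ 2 - 3 * T + 3 := by linear_combination h3 - hrk
  have hY : Y = (3 - T) * (T - 2) ^ 2 := by
    rw [hDT, hA2] at hD
    linear_combination hD
  refine ⟨hT0, ?_, hcT, hkT, hrk, hA2, hY, ?_⟩
  · nlinarith [mul_nonneg hr hk.le]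
  · apply mul_left_cancel₀ hk.ne'
    rw [hA2] at h6
    linear_combination (-1/2 : ℝ) * h6 + (1/2) * (T ^ 2 - 3 * T + 3) * hrk + (T / 2 - 1) * hkT

theorem caseII_core {n : ℕ} {a b : ℕ → Fin n → ℂ} {c : ℝ} (h : Good a b c) (hc : 0 < c) (β : ℂ)
    (b2 : b 2 = β • a 3) (a4 : a 4 = 0) (b3 : b 3 = 0) (b4 : b 4 = 0) (ha3 : a 3 ≠ 0) :
    CoreConcl a b c := by
  have A11 := h.A11
  have A12 := h.A12
  have A13 := h.A13
  have A22 := h.A22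
  have A23 := h.A23
  have A24 := h.A24
  have A33 := h.A33
  have A34 := h.A34
  have A44 := h.A44
  have B00 := h.B00
  have B01 := h.B01
  have B02 := h.B02
  have B11 := h.B11
  have B12 := h.B12
  have hk : 0 < nsq (a 3) := nsq_pos ha3
  have hk0 : hinner (a 3) (a 3) ≠ 0 := by rw [hi_self]; exact_mod_cast hk.ne'
  simp only [wd, a4, b3, b4, b2, hi_zero_left, hi_zero_right, hi_smul_left, hi_smul_right]
    at A12 A13 A22 A23 A24 A33 A34 A44 B00 B01 B02 B11 B12
  have h13 : hinner (a 1) (a 3) = 0 := by linear_combination A13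
  have h31 := hi0 h13
  have h23 : hinner (a 2) (a 3) = 0 := by linear_combination A23 - B01 / 2
  have h32 := hi0 h23
  have hkc : nsq (a 3) = 4 - c := by
    have : hinner (a 3) (a 3) = 4 - c := by linear_combination A33 - B11 / 4
    rw [hi_self] at this
    exact_mod_cast this
  have hP : hinner (a 1) (b 1) * hinner (b 1) (a 3) = 0 := by
    linear_combination -4 * A24 + B02 + hinner (b 1) (b 1) * h13
  have hQ : (starRingEnd ℂ) β * hinner (b 1) (a 3) = 0 := by
    have : ((starRingEnd ℂ) β * hinner (b 1) (a 3)) * ((starRingEnd ℂ) β * hinner (b 1) (a 3)) = 0 := by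
      linear_combination 3 * A24 - B02 + (starRingEnd ℂ) β * hinner (b 1) (a 3) * A12 - (starRingEnd ℂ) β * hinner (b 1) (a 2) * h13
    exact mul_self_eq_zero.1 this
  have h12 : hinner (a 1) (a 2) = 0 := by linear_combination A12 - hQ
  have h21 := hi0 h12
  have a11r : nsq (a 1) + nsq (b 1) = 4 := by
    rw [hi_self, hi_self] at A11
    exact_mod_cast A11
  have b00r : nsq (a 1) * nsq (b 1) - normSq (hinner (a 1) (b 1)) = c := by
    rw [hi_nsq, hi_self, hi_self] at B00
    have : (nsq (a 1) : ℂ) * nsq (b 1) - normSq (hinner (a 1) (b 1)) = c := by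
      linear_combination B00
    exact_mod_cast this
  by_cases hb13 : hinner (b 1) (a 3) = 0
  swap
  · exfalso
    have hab : hinner (a 1) (b 1) = 0 := by
      rcases mul_eq_zero.1 hP with h | h
      · exact h
      · exact absurd h hb13
    have hβ : β = 0 := by
      rcases mul_eq_zero.1 hQ with h | h
      · simpa using h
      · exact absurd h hb13
    subst hβ
    simp only [map_zero, zero_smul] at *
    have h2b : hinner (a 2) (b 1) = 0 := by
      have : hinner (a 2) (b 1) * hinner (b 1) (a 3) = 0 := by
        linear_combination (-1 / 6) * B12 + hinner (b 1) (b 1) * h23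
      rcases mul_eq_zero.1 this with h | h
      · exact h
      · exact absurd h hb13
    have l := h.LB1 0 b2 b3 b4 (by simp [a4]) h12 h13 h23 h2b (by rw [hi0 hab, mul_zero])
    have A44' : hinner (a 3) (a 3) * hinner (b 1) (b 1) - hinner (a 3) (b 1) * hinner (b 1) (a 3) = 1 := by
      linear_combination A44
    rw [hi_nsq, hi_self, hi_self] at A44'
    have A44r : nsq (a 3) * nsq (b 1) - normSq (hinner (a 3) (b 1)) = 1 := by exact_mod_cast A44'
    obtain ⟨l1, l2⟩ := l
    rw [hab, map_zero] at l1 b00r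
    have q1 : nsq (a 1) = c := by linear_combination l1 - nsq (a 1) * A44r
    have q2 : nsq (b 1) = 1 := by
      rw [q1] at b00r
      apply mul_left_cancel₀ hc.ne'
      linarith
    have q3 : c = 3 := by linarith
    have : normSq (hinner (a 3) (b 1)) = 0 := by
      rw [hkc, q2, q3] at A44r
      linarith
    exact hb13 (hi0 (normSq_eq_zero.1 this))
  have hb31 := hi0 hb13
  by_cases hab : hinner (a 1) (b 1) = 0
  swap
  · exfalso
    have hba : hinner (b 1) (a 1) ≠ 0 := fun h => hab (hi0 h)
    have h2b' : hinner (b 1) (a 2) = 0 := by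
      have : hinner (a 1) (b 1) * hinner (b 1) (a 2) = 0 := by
        simp only [h13, hb13, h12] at B01
        linear_combination (-1/2) * B01
      rcases mul_eq_zero.1 this with h | h
      · exact absurd h hab
      · exact h
    have h2b := hi0 h2b'
    have hβ : β = 0 := by
      simp only [h13, hb13, h12, h23, h2b, h2b', hb31, h21, h31, h32] at A34
      have : hinner (a 1) (b 1) * hinner (a 3) (a 3) * β = 0 := by
        linear_combination -A34
      rcases mul_eq_zero.1 this with h | h
      · exact absurd h (mul_ne_zero hab hk0)
      · exact h
    subst hβ
    simp only [map_zero, zero_smul] at *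
    have l := h.LB1 0 b2 b3 b4 (by simp [a4]) h12 h13 h23 h2b (by rw [hb31, zero_mul])
    obtain ⟨l1, l2⟩ := l
    have A44' : hinner (a 3) (a 3) * hinner (b 1) (b 1) = 1 := by
      linear_combination A44 + hinner (b 1) (a 3) * hb31
    rw [hi_self, hi_self] at A44'
    have A44r : nsq (a 3) * nsq (b 1) = 1 := by exact_mod_cast A44'
    rw [hb31, map_zero] at l1 l2
    have q3 : nsq (a 3) = 1 := by
      apply mul_left_cancel₀ hc.ne'
      rw [← b00r] at l1 ⊢
      linear_combination l1
    have q4 : c = 3 := by linarith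
    have q5 : nsq (b 1) = 1 := by rw [q3] at A44r; linarith
    have : normSq (hinner (a 1) (b 1)) = 0 := by
      rw [q5, q4] at b00r
      linarith
    exact hab (normSq_eq_zero.1 this)
  have hba := hi0 hab
  obtain ⟨l1, l2⟩ := h.LB2 β b2 b3 b4 a4 h12 h13 h23 hab hb31
  have nb := mul_conj β
  have hre : β * hinner (a 2) (b 1) + (starRingEnd ℂ) β * hinner (b 1) (a 2)
      = 2 * ((β * hinner (a 2) (b 1)).re : ℂ) := by
    rw [← hi_conj (a 2) (b 1), ← map_mul, add_conj]; push_cast; ring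
  have n2 := hi_nsq (a 2) (b 1)
  have E3 : nsq (a 2) + normSq β * nsq (a 3) + nsq (a 1) * nsq (b 1) = 6 := by
    have : hinner (a 2) (a 2) + (β * (starRingEnd ℂ) β) * hinner (a 3) (a 3) +
      hinner (a 1) (a 1) * hinner (b 1) (b 1) = 6 := by
      linear_combination A22 + hinner (b 1) (a 1) * hab
    rw [nb, hi_self, hi_self, hi_self, hi_self] at this
    exact_mod_cast this
  have E5 : nsq (a 1) * normSq β * nsq (a 3) + (nsq (a 2) * nsq (b 1) - normSq (hinner (a 2) (b 1))) = c := by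
    have : hinner (a 1) (a 1) * (β * (starRingEnd ℂ) β) * hinner (a 3) (a 3) +
      (hinner (a 2) (a 2) * hinner (b 1) (b 1) - hinner (a 2) (b 1) * hinner (b 1) (a 2)) = c := by
      simp only [h13, hb13, h12, h23, hb31, h21, h31, h32, hab, hba] at B11
      linear_combination B11 / 4
    rw [nb, n2, hi_self, hi_self, hi_self, hi_self] at this
    exact_mod_cast this
  have E6 : nsq (a 3) * (nsq (a 2) * normSq β - 2 * (β * hinner (a 2) (b 1)).re + nsq (b 1)) = 1 := by
    have : hinner (a 3) (a 3) * (hinner (a 2) (a 2) * (β * (starRingEnd ℂ) β) -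
      (β * hinner (a 2) (b 1) + (starRingEnd ℂ) β * hinner (b 1) (a 2)) + hinner (b 1) (b 1)) = 1 := by
      simp only [h13, hb13, h12, h23, hb31, h21, h31, h32, hab, hba] at A44
      linear_combination A44
    rw [nb, hre, hi_self, hi_self, hi_self] at this
    exact_mod_cast this
  rw [hab, map_zero, sub_zero] at b00r
  obtain ⟨t0, t3, tc, tk, tr, tA2, tY, te⟩ := caseII_alg (nsq (a 1)) (nsq (b 1)) c (nsq (a 3)) (normSq β)
    (nsq (a 2)) (normSq (hinner (a 2) (b 1))) _ hc (nsq_nonneg _) (normSq_nonneg _) hk a11r b00r E3 hkc E5 E6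
    l1 l2
  generalize hTT : nsq (a 1) = T at *
  have hBT : nsq (b 1) = 4 - T := by linarith
  have hβy : β * hinner (a 2) (b 1) = ((3 - T : ℝ) : ℂ) := by
    have q1 : normSq (β * hinner (a 2) (b 1)) = (3 - T) ^ 2 := by
      rw [normSq_mul, tY, ← tk]
      linear_combination (3 - T) * tr
    rw [normSq_apply, te] at q1
    have q2 : (β * hinner (a 2) (b 1)).im = 0 := by
      have : (β * hinner (a 2) (b 1)).im * (β * hinner (a 2) (b 1)).im = 0 := by linarith
      exact mul_self_eq_zero.1 this
    apply Complex.ext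
    · rw [te, ofReal_re]
    · rw [q2, ofReal_im]
  -- the phase
  have hph : ∃ e : ℂ, e * (starRingEnd ℂ) e = 1 ∧
      (starRingEnd ℂ) e * hinner (a 2) (b 1) = ((|T - 2| * Real.sqrt (3 - T) : ℝ) : ℂ) ∧
      (starRingEnd ℂ) e * (starRingEnd ℂ) β * hinner (a 3) (a 3) = ((|T - 2| * Real.sqrt (3 - T) : ℝ) : ℂ) := by
    by_cases hβ : β = 0
    · subst hβ
      have hT3 : T = 3 := by
        rw [map_zero] at tr; linarith
      have hy : hinner (a 2) (b 1) = 0 := by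
        apply normSq_eq_zero.1
        rw [tY, hT3]; norm_num
      refine ⟨1, by simp, ?_, ?_⟩
      · rw [hy, hT3]; simp
      · rw [hT3]; simp
    · have hN : 0 < Real.sqrt (normSq β) := Real.sqrt_pos.2 (normSq_pos.2 hβ)
      have hNN : Real.sqrt (normSq β) * Real.sqrt (normSq β) = normSq β :=
        Real.mul_self_sqrt (normSq_nonneg _)
      generalize Real.sqrt (normSq β) = N at *
      have hM : |T - 2| * N = Real.sqrt (3 - T) := by
        have : 3 - T = (|T - 2| * N) ^ 2 := by
          rw [← tr, ← hNN, tk, ← sq_abs (T - 2)]; ring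
        rw [this, Real.sqrt_sq (by positivity)]
      have hN0 : (N : ℂ) ≠ 0 := by exact_mod_cast hN.ne'
      have hNNc : (N : ℂ) * N = β * (starRingEnd ℂ) β := by rw [nb]; exact_mod_cast hNN
      have hs : Real.sqrt (3 - T) * Real.sqrt (3 - T) = 3 - T := Real.mul_self_sqrt (by linarith)
      have hMc : (|T - 2| * Real.sqrt (3 - T) : ℝ) * (N : ℂ) = ((3 - T : ℝ) : ℂ) := by
        have : (|T - 2| * Real.sqrt (3 - T) : ℝ) * N = 3 - T := by
          linear_combination Real.sqrt (3 - T) * hM + hs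
        exact_mod_cast this
      refine ⟨(starRingEnd ℂ) β / N, ?_, ?_, ?_⟩
      · simp only [map_div₀, conj_conj, conj_ofReal]
        field_simp
        linear_combination -hNNc
      · simp only [map_div₀, conj_conj, conj_ofReal]
        rw [div_mul_eq_mul_div, hβy, ← hMc]
        field_simp
      · simp only [map_div₀, conj_conj, conj_ofReal]
        rw [div_mul_eq_mul_div, nb, hi_self, div_mul_eq_mul_div]
        have : ((normSq β : ℝ) : ℂ) * ((nsq (a 3) : ℝ) : ℂ) = ((3 - T : ℝ) : ℂ) := by exact_mod_cast tr
        rw [this, ← hMc]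
        field_simp
  obtain ⟨e, he, p1, p2⟩ := hph
  have p1' : e * hinner (b 1) (a 2) = ((|T - 2| * Real.sqrt (3 - T) : ℝ) : ℂ) := by
    have := congrArg (starRingEnd ℂ) p1
    rw [map_mul, hi_conj, conj_conj, conj_ofReal] at this
    exact this
  have q1 : hinner (a 1) (a 1) = T := by rw [hi_self, hTT]
  have q2 : hinner (a 2) (a 2) = T ^ 2 - 3 * T + 3 := by rw [hi_self, tA2]; push_cast; ring
  have q3 : hinner (a 3) (a 3) = (T - 2) ^ 2 := by rw [hi_self, tk]; push_cast; ring
  have q4 : hinner (b 1) (b 1) = 4 - T := by rw [hi_self, hBT]; push_cast; ring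
  have q5 : β * (starRingEnd ℂ) β * hinner (a 3) (a 3) = 3 - T := by
    rw [nb, hi_self]
    exact_mod_cast tr
  have r1 : rot 1 0 a b = a := by funext k; simp [rot]
  refine ⟨T, t0, t3, tc, 1, 0, 0, e, uni_phase e he, ?_, ?_, ?_⟩
  · intro z w
    rw [r1]
    simp [ab4, h.a0, a4, hi_add_left, hi_add_right, hi_smul_left, hi_smul_right, hi_zero_left, hi_zero_right,
      h12, h21, h13, h31, h23, h32]
    rw [q1, q2, q3]; ring
  · intro z w
    simp [ab4, rot, h.b0, b3, b4, b2, hi_add_left, hi_add_right, hi_smul_left, hi_smul_right, hi_zero_left, hi_zero_right, hb13, hb31]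
    linear_combination (z * (starRingEnd ℂ) w) * (e * (starRingEnd ℂ) e * q4 + (4 - T) * he) + (z * (starRingEnd ℂ) w) ^ 2 * (e * (starRingEnd ℂ) e * q5 + (3 - T) * he)
  · intro z w
    rw [r1]
    generalize ((|T - 2| * Real.sqrt (3 - T) : ℝ) : ℂ) = M at *
    simp [ab4, rot, h.b0, h.a0, a4, b3, b4, b2, hi_add_left, hi_add_right, hi_smul_left, hi_smul_right, hi_zero_left, hi_zero_right, hb13, hb31, hab, h13, h23]
    linear_combination z ^ 2 * (starRingEnd ℂ) w * p1 + z ^ 3 * (starRingEnd ℂ) w ^ 2 * p2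


theorem uni_killv {n : ℕ} (u v : Fin n → ℂ)
    (h : hinner u u * hinner v v - hinner u v * hinner v u = 0) :
    ∃ p q r s : ℂ, Uni p q r s ∧ r • u + s • v = 0 := by
  by_cases hu : u = 0
  · refine ⟨0, 1, 1, 0, ?_, ?_⟩
    · constructor <;> simp
    · simp [hu]
  · obtain ⟨μ, rfl⟩ := hi_cs_eq hu h
    obtain ⟨p, q, r, s, U, e⟩ := uni_kill 1 μ
    refine ⟨p, q, r, s, U, ?_⟩
    rw [smul_smul, ← add_smul]
    have : r + s * μ = 0 := by linear_combination e
    rw [this, zero_smul]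

theorem caseII {n : ℕ} {a b : ℕ → Fin n → ℂ} {c : ℝ} (h : Good a b c) (hc : 0 < c)
    (a4 : a 4 = 0) (b4 : b 4 = 0) : CoreConcl a b c := by
  have A66 := h.A66
  simp only [wd, a4, b4, hi_zero_left, hi_zero_right] at A66
  obtain ⟨p, q, r, s, U, e⟩ := uni_killv (a 3) (b 3) (by linear_combination A66)
  apply CoreConcl.of_rot U
  have h' := h.rot U
  have b3' : rot r s a b 3 = 0 := e
  have a4' : rot p q a b 4 = 0 := by simp [rot, a4, b4]
  have b4' : rot r s a b 4 = 0 := by simp [rot, a4, b4]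
  generalize rot p q a b = a' at *
  generalize rot r s a b = b' at *
  by_cases ha3 : a' 3 = 0
  · exact caseIII h' ha3 a4' b3' b4'
  · have A55 := h'.A55
    simp only [wd, a4', b4', b3', hi_zero_left, hi_zero_right] at A55
    obtain ⟨β, hβ⟩ := hi_cs_eq ha3 (w := b' 2) (by linear_combination A55)
    exact caseII_core h' hc β hβ a4' b3' b4' ha3

theorem caseI_shape {n : ℕ} {a b : ℕ → Fin n → ℂ} {c : ℝ} (h : Good a b c) (ha4 : a 4 ≠ 0)
    (b4 : b 4 = 0) : ∃ β γ δ : ℂ, b 3 = β • a 4 ∧ b 2 = β • a 3 + γ • a 4 ∧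
      b 1 = β • a 2 + γ • a 3 + δ • a 4 := by
  have A77 := h.A77
  have A66 := h.A66
  have A55 := h.A55
  simp only [wd, b4, hi_zero_left, hi_zero_right] at A77
  obtain ⟨β, hβ⟩ := hi_cs_eq ha4 (w := b 3) (by linear_combination A77)
  simp only [wd, b4, hβ, hi_zero_left, hi_zero_right, hi_smul_left, hi_smul_right] at A66
  obtain ⟨γ, hγ⟩ := hi_cs_eq ha4 (w := b 2 - β • a 3) (by
    simp only [hi_sub_left, hi_sub_right, hi_smul_left, hi_smul_right]
    linear_combination A66)
  have hγ' : b 2 = β • a 3 + γ • a 4 := by rw [← hγ]; abel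
  simp only [wd, b4, hβ, hγ', hi_zero_left, hi_zero_right, hi_smul_left, hi_smul_right, hi_add_left, hi_add_right] at A55
  obtain ⟨δ, hδ⟩ := hi_cs_eq ha4 (w := b 1 - β • a 2 - γ • a 3) (by
    simp only [hi_sub_left, hi_sub_right, hi_smul_left, hi_smul_right]
    linear_combination A55)
  exact ⟨β, γ, δ, hβ, hγ', by rw [← hδ]; abel⟩


theorem Good.LB3 {n : ℕ} {a b : ℕ → Fin n → ℂ} {c : ℝ} (h : Good a b c) (β : ℂ)
    (b1 : b 1 = β • a 2) (b2 : b 2 = β • a 3) (b3 : b 3 = β • a 4) (b4 : b 4 = 0)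
    (h12 : hinner (a 1) (a 2) = 0) (h13 : hinner (a 1) (a 3) = 0) (h14 : hinner (a 1) (a 4) = 0)
    (h23 : hinner (a 2) (a 3) = 0) (h24 : hinner (a 2) (a 4) = 0) (h34 : hinner (a 3) (a 4) = 0) :
    normSq β * nsq (a 3) * nsq (a 4) * (1 + normSq β * nsq (a 1)) = c := by
  have h12' := hi0 h12
  have h13' := hi0 h13
  have h14' := hi0 h14
  have h23' := hi0 h23
  have h24' := hi0 h24
  have h34' := hi0 h34
  have g1 := hi_self (a 1)
  have g2 := hi_self (a 2)
  have g3 := hi_self (a 3)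
  have g4 := hi_self (a 4)
  have nb := mul_conj β
  generalize hk : (starRingEnd ℂ) β = B at *
  generalize hA1 : ((nsq (a 1) : ℝ) : ℂ) = A1 at *
  generalize hA2 : ((nsq (a 2) : ℝ) : ℂ) = A2 at *
  generalize hA3 : ((nsq (a 3) : ℝ) : ℂ) = A3 at *
  generalize hA4 : ((nsq (a 4) : ℝ) : ℂ) = A4 at *
  have c2 : (starRingEnd ℂ) 2 = 2 := map_ofNat _ 2
  have c3 : (starRingEnd ℂ) 3 = 3 := map_ofNat _ 3
  have e : ∀ z : ℂ, _ := fun z => h.Be z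
      ![![A1 * z + A2 * z ^ 2 + A3 * z ^ 3 + A4 * z ^ 4, B * (A2 * z ^ 2 + A3 * z ^ 3 + A4 * z ^ 4),
          A1 * z + 2 * A2 * z ^ 2 + 3 * A3 * z ^ 3 + 4 * A4 * z ^ 4, B * (A2 * z ^ 2 + 2 * A3 * z ^ 3 + 3 * A4 * z ^ 4)],
        ![β * (A2 * z + A3 * z ^ 2 + A4 * z ^ 3), β * B * (A2 * z + A3 * z ^ 2 + A4 * z ^ 3),
          β * (2 * A2 * z + 3 * A3 * z ^ 2 + 4 * A4 * z ^ 3), β * B * (A2 * z + 2 * A3 * z ^ 2 + 3 * A4 * z ^ 3)],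
        ![A1 + 2 * A2 * z + 3 * A3 * z ^ 2 + 4 * A4 * z ^ 3, B * (2 * A2 * z + 3 * A3 * z ^ 2 + 4 * A4 * z ^ 3),
          A1 + 4 * A2 * z + 9 * A3 * z ^ 2 + 16 * A4 * z ^ 3, B * (2 * A2 * z + 6 * A3 * z ^ 2 + 12 * A4 * z ^ 3)],
        ![β * (A2 + 2 * A3 * z + 3 * A4 * z ^ 2), β * B * (A2 + 2 * A3 * z + 3 * A4 * z ^ 2),
          β * (2 * A2 + 6 * A3 * z + 12 * A4 * z ^ 2), β * B * (A2 + 4 * A3 * z + 9 * A4 * z ^ 2)]]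
      (by
        intro i j
        fin_cases i <;> fin_cases j <;>
        simp [c2, c3, -mul_eq_mul_right_iff, -mul_eq_mul_left_iff, -mul_eq_zero, bigU, ab4, dsq, h.a0, h.b0, b1, b2, b3, b4, h.a5, h.b5, hi_add_left, hi_add_right,
          hi_smul_left, hi_smul_right, hi_zero_left, hi_zero_right,
          h12, h13, h14, h23, h24, h34, h12', h13', h14', h23', h24', h34', g1, g2, g3, g4, hk] <;> ring)
  simp [D3, D4] at e
  have : (β * B) * A3 * A4 * (1 + (β * B) * A1) = c := by
    linear_combination (e 2 - 4 * e 1 + 6 * e 0 - 4 * e (-1) + e (-2))/24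
  rw [nb, ← hA1, ← hA3, ← hA4] at this
  exact_mod_cast this

theorem caseI_ne {n : ℕ} {a b : ℕ → Fin n → ℂ} {c : ℝ} (h : Good a b c) (hc : 0 < c) (ha4 : a 4 ≠ 0)
    (b4 : b 4 = 0) (β γ δ : ℂ) (b3 : b 3 = β • a 4) (b2 : b 2 = β • a 3 + γ • a 4)
    (b1 : b 1 = β • a 2 + γ • a 3 + δ • a 4) (hβ : β ≠ 0) : False := by
  have A11 := h.A11
  have A12 := h.A12
  have A13 := h.A13
  have A14 := h.A14
  have A22 := h.A22
  have A23 := h.A23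
  have A24 := h.A24
  have A33 := h.A33
  have A34 := h.A34
  have A44 := h.A44
  have B00 := h.B00
  have B01 := h.B01
  have B02 := h.B02
  have B04 := h.B04
  have B11 := h.B11
  have B12 := h.B12
  have hcβ : (starRingEnd ℂ) β ≠ 0 := by simpa using hβ
  simp only [wd, b2, b3, b4, hi_zero_left, hi_zero_right, hi_smul_left, hi_smul_right, hi_add_left, hi_add_right]
    at A12 A13 A14 A22 A23 A24 A33 A34 A44 B00 B01 B02 B04 B11 B12
  have h14 : hinner (a 1) (a 4) = 0 := by linear_combination A14
  have h41 := hi0 h14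
  have P1 : hinner (b 1) (a 4) = 0 := by
    have : ((starRingEnd ℂ) β * hinner (b 1) (a 4)) * ((starRingEnd ℂ) β * hinner (b 1) (a 4)) = 0 := by
      rw [h14] at B04
      linear_combination -B04 + ((starRingEnd ℂ) β * hinner (b 1) (a 4)) * A13
    have := mul_self_eq_zero.1 this
    exact (mul_eq_zero.1 this).resolve_left hcβ
  have P1' := hi0 P1
  have h13 : hinner (a 1) (a 3) = 0 := by linear_combination A13 - (starRingEnd ℂ) β * P1
  have h31 := hi0 h13
  have hab : hinner (a 1) (b 1) = (starRingEnd ℂ) β * hinner (a 1) (a 2) := by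
    rw [b1]; simp only [hi_add_right, hi_smul_right, h13, h14]; ring
  have P2 : hinner (b 1) (a 3) = 0 := by
    have : ((starRingEnd ℂ) β * hinner (b 1) (a 3)) * ((starRingEnd ℂ) β * hinner (b 1) (a 3)) = 0 := by
      simp only [h14, h13, P1, hab] at B02 A12
      linear_combination -B02 + ((starRingEnd ℂ) β * hinner (b 1) (a 3)) * A12
    have := mul_self_eq_zero.1 this
    exact (mul_eq_zero.1 this).resolve_left hcβ
  have P2' := hi0 P2
  have h12 : hinner (a 1) (a 2) = 0 := by
    rw [P1, P2] at A12; linear_combination A12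
  have h21 := hi0 h12
  rw [h12, mul_zero] at hab
  have hba := hi0 hab
  have h24 : hinner (a 2) (a 4) = 0 := by
    simp only [h14, h13, h12, P1, P2, hab] at A24
    linear_combination A24
  have h42 := hi0 h24
  have hBB : hinner (b 1) (b 1) = (starRingEnd ℂ) β * hinner (b 1) (a 2) := by
    conv_lhs => rw [b1]
    rw [← b1]
    have : hinner (b 1) (b 1) = hinner (b 1) (β • a 2 + γ • a 3 + δ • a 4) := by rw [← b1]
    rw [this]
    simp only [hi_add_right, hi_smul_right, P1, P2]; ring
  have hA1B1 : hinner (a 1) (a 1) * hinner (b 1) (b 1) = c := by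
    rw [hab] at B00; linear_combination B00
  have h23 : hinner (a 2) (a 3) = 0 := by
    simp only [h14, h13, h12, h21, h31, h41, h24, h42, P1, P2, P1', P2', hab, hba] at A34 B12 A23 B01
    have e1 : hinner (a 2) (a 3) * (6 * hinner (a 1) (a 1) + 2 * hinner (b 1) (b 1)) = 0 := by
      linear_combination 6 * hinner (a 1) (a 1) * A23 - B12 + 8 * hinner (a 2) (a 3) * hBB
    rcases mul_eq_zero.1 e1 with h | h
    · exact h
    · exfalso
      have e2 := hA1B1
      rw [hi_self, hi_self] at h e2
      have h' : 6 * nsq (a 1) + 2 * nsq (b 1) = 0 := by exact_mod_cast h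
      have e2' : nsq (a 1) * nsq (b 1) = c := by exact_mod_cast e2
      nlinarith [nsq_nonneg (a 1), nsq_nonneg (b 1)]
  have h32 := hi0 h23
  have h34 : hinner (a 3) (a 4) = 0 := by
    simp only [h14, h13, h12, h21, h31, h41, h24, h42, h23, h32, P1, P2, P1', P2', hab, hba] at A34 A23
    linear_combination A34 - hinner (a 1) (a 1) * A23
  have h43 := hi0 h34
  have h44 : hinner (a 4) (a 4) ≠ 0 := fun h' => ha4 (hi_self_eq_zero h')
  have hγ : γ = 0 := by
    simp only [h14, h13, h12, h21, h31, h41, h24, h42, h23, h32, h34, h43, P1, P2, P1', P2', hab, hba] at A23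
    have : (starRingEnd ℂ) β * hinner (a 4) (a 4) * γ = 0 := by linear_combination A23
    exact (mul_eq_zero.1 this).resolve_left (mul_ne_zero hcβ h44)
  have hδ : δ = 0 := by
    rw [b1] at P1
    simp only [hi_add_left, hi_smul_left, h24, h34] at P1
    have : hinner (a 4) (a 4) * δ = 0 := by linear_combination P1
    exact (mul_eq_zero.1 this).resolve_left h44
  subst hγ
  subst hδ
  simp only [zero_smul, add_zero] at b1 b2
  have l := h.LB3 β b1 b2 b3 b4 h12 h13 h14 h23 h24 h34
  simp only [b1, hi_smul_left, hi_smul_right, h14, h13, h12, h21, h31, h41, h24, h42, h23, h32, h34, h43, P1, P2, P1', P2', hab, hba, map_zero] at A11 A22 A44 B00 B11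
  have nb := mul_conj β
  have E1 : nsq (a 1) + normSq β * nsq (a 2) = 4 := by
    have : hinner (a 1) (a 1) + (β * (starRingEnd ℂ) β) * hinner (a 2) (a 2) = 4 := by linear_combination A11
    rw [nb, hi_self, hi_self] at this
    exact_mod_cast this
  have E2 : nsq (a 1) * (normSq β * nsq (a 2)) = c := by
    have : hinner (a 1) (a 1) * ((β * (starRingEnd ℂ) β) * hinner (a 2) (a 2)) = c := by linear_combination B00
    rw [nb, hi_self, hi_self] at this
    exact_mod_cast this
  have E3 : nsq (a 2) + normSq β * nsq (a 3) = 6 - c := by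
    have : hinner (a 2) (a 2) + (β * (starRingEnd ℂ) β) * hinner (a 3) (a 3) = 6 - c := by linear_combination A22 - B00
    rw [nb, hi_self, hi_self] at this
    exact_mod_cast this
  have E4 : nsq (a 1) * (normSq β * nsq (a 3)) = c := by
    have : hinner (a 1) (a 1) * ((β * (starRingEnd ℂ) β) * hinner (a 3) (a 3)) = c := by linear_combination B11 / 4
    rw [nb, hi_self, hi_self] at this
    exact_mod_cast this
  have E5 : nsq (a 4) * (1 + normSq β * nsq (a 1)) = 1 := by
    have : hinner (a 4) (a 4) * (1 + (β * (starRingEnd ℂ) β) * hinner (a 1) (a 1)) = 1 := by linear_combination A44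
    rw [nb, hi_self, hi_self] at this
    exact_mod_cast this
  have E6 : normSq β * nsq (a 3) = c := by linear_combination l - normSq β * nsq (a 3) * E5
  have E7 : nsq (a 1) = 1 := by
    rw [E6] at E4
    apply mul_right_cancel₀ hc.ne'
    linarith
  have E8 : nsq (a 2) = 0 := by
    rw [E7] at E1 E2
    linarith
  rw [E8] at E2
  simp at E2
  linarith


theorem Good.LB4 {n : ℕ} {a b : ℕ → Fin n → ℂ} {c : ℝ} (h : Good a b c) (γ : ℂ)
    (b1 : b 1 = γ • a 3) (b2 : b 2 = γ • a 4) (b3 : b 3 = 0) (b4 : b 4 = 0)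
    (h12 : hinner (a 1) (a 2) = 0) (h13 : hinner (a 1) (a 3) = 0) (h14 : hinner (a 1) (a 4) = 0)
    (h23 : hinner (a 2) (a 3) = 0) (h24 : hinner (a 2) (a 4) = 0) (h34 : hinner (a 3) (a 4) = 0) :
    16 * normSq γ * nsq (a 2) * nsq (a 4) + normSq γ ^ 2 * nsq (a 1) * nsq (a 3) * nsq (a 4)
      + normSq γ * nsq (a 1) * nsq (a 2) * nsq (a 3) = 6 * c ∧
    normSq γ * nsq (a 3) * nsq (a 4) + normSq γ ^ 2 * nsq (a 2) * nsq (a 3) * nsq (a 4)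
      + normSq γ * nsq (a 1) * nsq (a 2) * nsq (a 4) = c := by
  have h12' := hi0 h12
  have h13' := hi0 h13
  have h14' := hi0 h14
  have h23' := hi0 h23
  have h24' := hi0 h24
  have h34' := hi0 h34
  have g1 := hi_self (a 1)
  have g2 := hi_self (a 2)
  have g3 := hi_self (a 3)
  have g4 := hi_self (a 4)
  have nb := mul_conj γ
  generalize hk : (starRingEnd ℂ) γ = G at *
  generalize hA1 : ((nsq (a 1) : ℝ) : ℂ) = A1 at *
  generalize hA2 : ((nsq (a 2) : ℝ) : ℂ) = A2 at *
  generalize hA3 : ((nsq (a 3) : ℝ) : ℂ) = A3 at *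
  generalize hA4 : ((nsq (a 4) : ℝ) : ℂ) = A4 at *
  have c2 : (starRingEnd ℂ) 2 = 2 := map_ofNat _ 2
  have c3 : (starRingEnd ℂ) 3 = 3 := map_ofNat _ 3
  have e : ∀ z : ℂ, _ := fun z => h.Be z
      ![![A1 * z + A2 * z ^ 2 + A3 * z ^ 3 + A4 * z ^ 4, G * (A3 * z ^ 3 + A4 * z ^ 4),
          A1 * z + 2 * A2 * z ^ 2 + 3 * A3 * z ^ 3 + 4 * A4 * z ^ 4, G * (A3 * z ^ 3 + 2 * A4 * z ^ 4)],
        ![γ * (A3 * z + A4 * z ^ 2), γ * G * (A3 * z + A4 * z ^ 2),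
          γ * (3 * A3 * z + 4 * A4 * z ^ 2), γ * G * (A3 * z + 2 * A4 * z ^ 2)],
        ![A1 + 2 * A2 * z + 3 * A3 * z ^ 2 + 4 * A4 * z ^ 3, G * (3 * A3 * z ^ 2 + 4 * A4 * z ^ 3),
          A1 + 4 * A2 * z + 9 * A3 * z ^ 2 + 16 * A4 * z ^ 3, G * (3 * A3 * z ^ 2 + 8 * A4 * z ^ 3)],
        ![γ * (A3 + 2 * A4 * z), γ * G * (A3 + 2 * A4 * z),
          γ * (3 * A3 + 8 * A4 * z), γ * G * (A3 + 4 * A4 * z)]]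
      (by
        intro i j
        fin_cases i <;> fin_cases j <;>
        simp [c2, c3, -mul_eq_mul_right_iff, -mul_eq_mul_left_iff, -mul_eq_zero, bigU, ab4, dsq, h.a0, h.b0, b1, b2, b3, b4, h.a5, h.b5, hi_add_left, hi_add_right,
          hi_smul_left, hi_smul_right, hi_zero_left, hi_zero_right,
          h12, h13, h14, h23, h24, h34, h12', h13', h14', h23', h24', h34', g1, g2, g3, g4, hk] <;> ring)
  simp [D3, D4] at e
  constructor
  · have : 16 * (γ * G) * A2 * A4 + (γ * G) ^ 2 * A1 * A3 * A4 + (γ * G) * A1 * A2 * A3 = 6 * c := by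
      linear_combination (- e 2 + 16 * e 1 - 30 * e 0 + 16 * e (-1) - e (-2))/24
    rw [nb, ← hA1, ← hA3, ← hA4, ← hA2] at this
    exact_mod_cast this
  · have : (γ * G) * A3 * A4 + (γ * G) ^ 2 * A2 * A3 * A4 + (γ * G) * A1 * A2 * A4 = c := by
      linear_combination (e 2 - 2 * e 1 + 2 * e (-1) - e (-2))/48
    rw [nb, ← hA1, ← hA3, ← hA4, ← hA2] at this
    exact_mod_cast this

theorem caseI_zero {n : ℕ} {a b : ℕ → Fin n → ℂ} {c : ℝ} (h : Good a b c) (hc : 0 < c) (ha4 : a 4 ≠ 0)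
    (b4 : b 4 = 0) (γ δ : ℂ) (b3 : b 3 = 0) (b2 : b 2 = γ • a 4)
    (b1 : b 1 = γ • a 3 + δ • a 4) : False := by
  have A11 := h.A11
  have A12 := h.A12
  have A13 := h.A13
  have A14 := h.A14
  have A22 := h.A22
  have A23 := h.A23
  have A24 := h.A24
  have A33 := h.A33
  have A34 := h.A34
  have A44 := h.A44
  have B00 := h.B00
  have B01 := h.B01
  have B11 := h.B11
  simp only [wd, b3, b4, hi_zero_left, hi_zero_right, hi_smul_left, hi_smul_right, hi_add_left, hi_add_right]
    at A13 A14 A22 A23 A24 A33 A34 A44 B00 B01 B11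
  have h14 : hinner (a 1) (a 4) = 0 := by linear_combination A14
  have h41 := hi0 h14
  have h13 : hinner (a 1) (a 3) = 0 := by linear_combination A13
  have h31 := hi0 h13
  have h23 : hinner (a 2) (a 3) = 0 := by linear_combination A23 - B01 / 2
  have h32 := hi0 h23
  have hab : hinner (a 1) (b 1) = 0 := by
    rw [b1]; simp only [hi_add_right, hi_smul_right, h13, h14]; ring
  have hab2 : hinner (a 1) (b 2) = 0 := by
    rw [b2]; simp only [hi_smul_right, h14]; ring
  have hkc : nsq (a 3) = 4 - c := by
    have : hinner (a 3) (a 3) = 4 - c := by linear_combination A33 - B11 / 4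
    rw [hi_self] at this
    exact_mod_cast this
  have E1 : nsq (a 1) + nsq (b 1) = 4 := by
    rw [hi_self, hi_self] at A11
    exact_mod_cast A11
  have E2 : nsq (a 1) * nsq (b 1) = c := by
    have : hinner (a 1) (a 1) * hinner (b 1) (b 1) = c := by
      linear_combination B00 + hinner (b 1) (a 1) * hab
    rw [hi_self, hi_self] at this
    exact_mod_cast this
  have hb1 : b 1 ≠ 0 := by
    intro h0
    rw [h0] at E2
    simp [nsq] at E2
    linarith
  by_cases ha3 : a 3 = 0
  · by_cases hγ : γ = 0
    · subst hγ
      have hδ : δ ≠ 0 := by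
        rintro rfl
        apply hb1
        rw [b1]; simp
      simp only [zero_smul, zero_add] at b1 b2
      rw [b2, hi_zero_right, add_zero] at A12
      have h24 : hinner (a 2) (a 4) = 0 := by
        simp only [b2, ha3, hi_zero_right, hab] at A24
        linear_combination A24
      have l := (h.LB1 δ⁻¹ b2 b3 b4 (by rw [b1, smul_smul, inv_mul_cancel₀ hδ, one_smul]) A12 h13 h23
        (by rw [b1, hi_smul_right, h24, mul_zero]) (by rw [ha3, hi_zero_left, zero_mul])).1
      rw [ha3] at l
      simp [nsq, hi_zero_left] at l
      linarith
    · have hz : sqv (dsq b) (-δ / (2 * γ)) = 0 := by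
        rw [ab4]
        simp [dsq, b3, b4, h.b5, b2, b1, ha3, smul_smul, ← add_smul]
        left
        field_simp
        ring
      have := h.B (-δ / (2 * γ)) (-δ / (2 * γ))
      rw [bigG_eq, Matrix.det_eq_zero_of_row_eq_zero 3] at this
      · generalize -δ / (2 * γ) = z at this
        have h2 : c * (1 + normSq z) ^ 4 = 0 := by
          rw [mul_conj] at this
          exact_mod_cast this.symm
        have : 0 < c * (1 + normSq z) ^ 4 := by
          have := normSq_nonneg z
          positivity
        linarith
      · intro j
        fin_cases j <;> simp [hz, hi_zero_left]
  · have hk := nsq_pos ha3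
    have hcc : hinner (b 1) (b 2) * (hinner (a 1) (a 1) - hinner (b 1) (b 1)) = 0 := by
      simp only [hab, hab2] at B01
      linear_combination B01 / 2 - hinner (b 1) (b 1) * A12
    have hbb : hinner (b 1) (b 2) = 0 := by
      rcases mul_eq_zero.1 hcc with h' | h'
      · exact h'
      · exfalso
        rw [hi_self, hi_self] at h'
        have : nsq (a 1) - nsq (b 1) = 0 := by exact_mod_cast h'
        have e1 : nsq (a 1) = 2 := by linarith
        have e2 : nsq (b 1) = 2 := by linarith
        rw [e1, e2] at E2
        linarith
    have h12 : hinner (a 1) (a 2) = 0 := by linear_combination A12 - hbb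
    have h21 := hi0 h12
    have h24 : hinner (a 2) (a 4) = 0 := by
      simp only [hab, hab2, h12, h13] at A24
      linear_combination A24
    have h42 := hi0 h24
    have h2b : hinner (a 2) (b 1) = 0 := by
      rw [b1]; simp only [hi_add_right, hi_smul_right, h23, h24]; ring
    have h2b2 : hinner (a 2) (b 2) = 0 := by
      rw [b2]; simp only [hi_smul_right, h24]; ring
    have h34 : hinner (a 3) (a 4) = 0 := by
      simp only [hab, hab2, h12, h13, h21, h23, h2b, h2b2, hbb] at A34
      linear_combination A34
    have h43 := hi0 h34
    have h44 : hinner (a 4) (a 4) ≠ 0 := fun h' => ha4 (hi_self_eq_zero h')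
    have hγδ : δ * (starRingEnd ℂ) γ = 0 := by
      rw [b1, b2] at hbb
      simp only [hi_add_left, hi_smul_left, hi_smul_right, h34] at hbb
      have : hinner (a 4) (a 4) * (δ * (starRingEnd ℂ) γ) = 0 := by linear_combination hbb
      exact (mul_eq_zero.1 this).resolve_left h44
    rcases mul_eq_zero.1 hγδ with hδ | hγ
    · subst hδ
      simp only [zero_smul, add_zero] at b1
      obtain ⟨l1, l2⟩ := h.LB4 γ b1 b2 b3 b4 h12 h13 h14 h23 h24 h34
      have nb := mul_conj γ
      have F1 : nsq (b 1) = normSq γ * nsq (a 3) := by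
        have : hinner (b 1) (b 1) = (γ * (starRingEnd ℂ) γ) * hinner (a 3) (a 3) := by
          rw [b1]; simp only [hi_smul_left, hi_smul_right]; ring
        rw [nb, hi_self, hi_self] at this
        exact_mod_cast this
      have F2 : nsq (a 2) + normSq γ * nsq (a 4) = 6 - c := by
        have : hinner (a 2) (a 2) + (γ * (starRingEnd ℂ) γ) * hinner (a 4) (a 4) = 6 - c := by
          rw [b2] at A22; simp only [hi_smul_left, hi_smul_right] at A22
          linear_combination A22 - B00
        rw [nb, hi_self, hi_self] at this
        exact_mod_cast this
      rw [F1] at E1 E2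
      generalize nsq (a 1) = x1 at *
      generalize nsq (a 2) = x2 at *
      generalize nsq (a 3) = x3 at *
      generalize nsq (a 4) = x4 at *
      generalize normSq γ = r at *
      subst hkc
      have G1 : 16 * (x2 * (r * x4)) = c ^ 2 := by
        linear_combination l1 - c * F2 - (r * x4 + x2) * E2
      have G2 : (4 - c) * (r * x4) = (4 - c) * (c / 4) := by
        linear_combination l2 - x2 * (r * x4) * E1 - G1 / 4
      have G3 := mul_left_cancel₀ hk.ne' G2
      rw [G3] at G1 F2
      have G4 : x2 = c / 4 := by
        apply mul_left_cancel₀ hc.ne'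
        linarith
      linarith
    · have hγ : γ = 0 := by simpa using hγ
      subst hγ
      have hδ : δ ≠ 0 := by
        rintro rfl
        apply hb1
        rw [b1]; simp
      simp only [zero_smul, zero_add] at b1 b2
      have h3b : hinner (a 3) (b 1) = 0 := by
        rw [b1, hi_smul_right, h34, mul_zero]
      have l := (h.LB1 δ⁻¹ b2 b3 b4 (by rw [b1, smul_smul, inv_mul_cancel₀ hδ, one_smul]) h12 h13 h23
        h2b (by rw [h3b, zero_mul])).1
      rw [hab, h3b, map_zero] at l
      have e3 : nsq (a 3) = 1 := by
        apply mul_left_cancel₀ hc.ne'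
        linear_combination l - nsq (a 3) * E2
      have e5 : nsq (a 4) + nsq (a 3) * nsq (b 1) = 1 := by
        have : hinner (a 4) (a 4) + hinner (a 3) (a 3) * hinner (b 1) (b 1) = 1 := by
          simp only [hab, hab2, h12, h13, h31, h21, h23, h32, h2b, b2, h3b, hi_zero_left, hi_zero_right] at A44
          linear_combination A44
        rw [hi_self, hi_self, hi_self] at this
        exact_mod_cast this
      have := nsq_pos ha4
      rw [e3] at e5 hkc
      have e6 : c = 3 := by linarith
      rw [e6] at E2
      have e7 : nsq (b 1) < 1 := by linarith
      nlinarith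

theorem core {n : ℕ} {a b : ℕ → Fin n → ℂ} {c : ℝ} (h : Good a b c) (hc : 0 < c) : CoreConcl a b c := by
  have A88 := h.A88
  simp only [wd] at A88
  obtain ⟨p, q, r, s, U, e⟩ := uni_killv (a 4) (b 4) A88
  apply CoreConcl.of_rot U
  have h' := h.rot U
  have b4' : rot r s a b 4 = 0 := e
  generalize rot p q a b = a' at *
  generalize rot r s a b = b' at *
  by_cases ha4 : a' 4 = 0
  · exact caseII h' hc ha4 b4'
  · exfalso
    obtain ⟨β, γ, δ, b3, b2, b1⟩ := caseI_shape h' ha4 b4'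
    by_cases hβ : β = 0
    · subst hβ
      simp only [zero_smul, zero_add] at b1 b2 b3
      exact caseI_zero h' hc ha4 b4' γ δ b3 b2 b1
    · exact caseI_ne h' hc ha4 b4' β γ δ b3 b2 b1 hβ


theorem poly_deg_le (p : Polynomial ℂ) (h : ∀ z : ℂ, ‖p.eval z‖ ≤ (1 + ‖z‖ ^ 2) ^ 2) :
    p.natDegree < 5 := by
  by_contra hN
  push Not at hN
  have h0 : p.leadingCoeff = 0 := by
    rw [← Polynomial.coeff_zero_reverse, Polynomial.coeff_zero_eq_eval_zero]
    have key : ∀ w : ℂ, w ≠ 0 → ‖p.reverse.eval w‖ ≤ ‖w‖ ^ (p.natDegree - 4) * (‖w‖ ^ 2 + 1) ^ 2 := by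
      intro w hw
      have hw' : w⁻¹ ≠ 0 := inv_ne_zero hw
      have e2 : p.reverse.eval w = w ^ p.natDegree * p.eval w⁻¹ := by
        letI : Invertible (w⁻¹) := invertibleOfNonzero hw'
        have e := Polynomial.eval₂_reverse_mul_pow (RingHom.id ℂ) (w⁻¹) p
        simp only [Polynomial.eval₂_id, invOf_eq_inv, inv_inv] at e
        rw [← e, mul_comm, mul_assoc, ← mul_pow, inv_mul_cancel₀ hw, one_pow, mul_one]
      rw [e2, norm_mul, norm_pow]
      have hn : 0 < ‖w‖ := norm_pos_iff.2 hw
      calc ‖w‖ ^ p.natDegree * ‖p.eval w⁻¹‖ ≤ ‖w‖ ^ p.natDegree * (1 + ‖w⁻¹‖ ^ 2) ^ 2 := by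
            gcongr; exact h _
        _ = ‖w‖ ^ (p.natDegree - 4) * (‖w‖ ^ 2 + 1) ^ 2 := by
            have : p.natDegree = (p.natDegree - 4) + 4 := by omega
            conv_lhs => rw [this]
            rw [norm_inv, pow_add]
            field_simp
    have t1 : Filter.Tendsto (fun w : ℂ => ‖p.reverse.eval w‖) (nhdsWithin 0 {0}ᶜ)
        (nhds ‖p.reverse.eval 0‖) :=
      (Continuous.tendsto (by fun_prop) 0).mono_left nhdsWithin_le_nhds
    have t2 : Filter.Tendsto (fun w : ℂ => ‖w‖ ^ (p.natDegree - 4) * (‖w‖ ^ 2 + 1) ^ 2) (nhdsWithin 0 {0}ᶜ)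
        (nhds (‖(0 : ℂ)‖ ^ (p.natDegree - 4) * (‖(0 : ℂ)‖ ^ 2 + 1) ^ 2)) :=
      (Continuous.tendsto (f := fun w : ℂ => ‖w‖ ^ (p.natDegree - 4) * (‖w‖ ^ 2 + 1) ^ 2) (by fun_prop) 0).mono_left nhdsWithin_le_nhds
    have := le_of_tendsto_of_tendsto t1 t2 (by
      filter_upwards [self_mem_nhdsWithin] with w hw
      exact key w hw)
    rw [norm_zero, zero_pow (by omega), zero_mul] at this
    exact norm_le_zero_iff.1 this
  have : p = 0 := Polynomial.leadingCoeff_eq_zero.1 h0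
  rw [this] at hN
  simp at hN

theorem poly_coeffs {n : ℕ} (F : ℂ → Fin n → ℂ) (hF : IsPolyMap F) (h0 : F 0 = 0)
    (hb : ∀ z, nsq (F z) ≤ (1 + normSq z) ^ 4) :
    ∃ a : ℕ → Fin n → ℂ, a 0 = 0 ∧ (∀ k, 5 ≤ k → a k = 0) ∧ F = sqv a := by
  choose P hP using hF
  have hd : ∀ i, (P i).natDegree < 5 := by
    intro i
    apply poly_deg_le
    intro z
    rw [← hP]
    have h1 : normSq (F z i) ≤ nsq (F z) :=
      Finset.single_le_sum (f := fun i => normSq (F z i)) (fun i _ => normSq_nonneg _) (Finset.mem_univ i)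
    have h2 := h1.trans (hb z)
    rw [normSq_eq_norm_sq, normSq_eq_norm_sq] at h2
    apply le_of_sq_le_sq _ (by positivity)
    calc ‖F z i‖ ^ 2 ≤ _ := h2
      _ = _ := by ring
  refine ⟨fun k i => (P i).coeff k, ?_, ?_, ?_⟩
  · funext i
    have := congrFun h0 i
    rw [hP] at this
    simpa [Polynomial.coeff_zero_eq_eval_zero] using this
  · intro k hk
    funext i
    exact Polynomial.coeff_eq_zero_of_natDegree_lt (lt_of_lt_of_le (hd i) hk)
  · funext z i
    rw [hP, Polynomial.eval_eq_sum_range' (hd i)]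
    simp [sqv, Finset.sum_apply, mul_comm]

theorem hasDeriv_sqv {n : ℕ} (a : ℕ → Fin n → ℂ) (h5 : ∀ k, 5 ≤ k → a k = 0) (z : ℂ) (i : Fin n) :
    HasDerivAt (fun z => sqv a z i) (sqv (dsq a) z i) z := by
  have e : (fun z => sqv a z i) = fun z => a 0 i + z * a 1 i + z ^ 2 * a 2 i + z ^ 3 * a 3 i + z ^ 4 * a 4 i := by
    funext z; rw [ab4]; simp
  rw [e]
  have := ((((hasDerivAt_const z (a 0 i)).add ((hasDerivAt_id z).mul_const (a 1 i))).add
    ((hasDerivAt_pow 2 z).mul_const (a 2 i))).add ((hasDerivAt_pow 3 z).mul_const (a 3 i))).add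
    ((hasDerivAt_pow 4 z).mul_const (a 4 i))
  refine this.congr_deriv ?_
  rw [ab4]
  simp [dsq, h5]
  ring

theorem deriv_vOne {n : ℕ} (a : ℕ → Fin n → ℂ) (h5 : ∀ k, 5 ≤ k → a k = 0) (z : ℂ) :
    deriv (vOne (sqv a)) z = Fin.cons 0 (Fin.cons 0 (sqv (dsq a) z)) := by
  apply HasDerivAt.deriv
  apply hasDerivAt_pi.2
  intro i
  refine Fin.cases ?_ (fun j => Fin.cases ?_ (fun k => ?_) j) i
  · simpa [vOne] using hasDerivAt_const z (1 : ℂ)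
  · simpa [vOne] using hasDerivAt_const z (0 : ℂ)
  · simpa [vOne] using hasDeriv_sqv a h5 z k

theorem deriv_vTwo {n : ℕ} (a : ℕ → Fin n → ℂ) (h5 : ∀ k, 5 ≤ k → a k = 0) (z : ℂ) :
    deriv (vTwo (sqv a)) z = Fin.cons 0 (Fin.cons 0 (sqv (dsq a) z)) := by
  apply HasDerivAt.deriv
  apply hasDerivAt_pi.2
  intro i
  refine Fin.cases ?_ (fun j => Fin.cases ?_ (fun k => ?_) j) i
  · simpa [vTwo] using hasDerivAt_const z (0 : ℂ)
  · simpa [vTwo] using hasDerivAt_const z (1 : ℂ)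
  · simpa [vTwo] using hasDeriv_sqv a h5 z k

theorem hi_cons {m : ℕ} (x y : ℂ) (u w : Fin m → ℂ) :
    hinner (Fin.cons x u : Fin (m + 1) → ℂ) (Fin.cons y w : Fin (m + 1) → ℂ) = x * (starRingEnd ℂ) y + hinner u w := by
  simp [hinner, Fin.sum_univ_succ]

theorem start {n : ℕ} (F₁ F₂ : ℂ → Fin n → ℂ)
    (hF₁ : IsPolyMap F₁) (hF₂ : IsPolyMap F₂)
    (h01 : F₁ 0 = 0) (h02 : F₂ 0 = 0) (c : ℝ)
    (hA : CondA 4 F₁ F₂) (hB : CondB 4 c F₁ F₂) :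
    ∃ a b, F₁ = sqv a ∧ F₂ = sqv b ∧ Good a b c := by
  have hAr : ∀ z, 1 + nsq (F₁ z) + nsq (F₂ z) + (nsq (F₁ z) * nsq (F₂ z) - normSq (hinner (F₁ z) (F₂ z)))
      = (1 + normSq z) ^ 4 := by
    intro z
    have := hA z
    rw [mul_conj, hi_self, hi_self] at this
    exact_mod_cast this
  have b1 : ∀ z, nsq (F₁ z) ≤ (1 + normSq z) ^ 4 := by
    intro z
    linarith [hAr z, hi_cs (F₁ z) (F₂ z), nsq_nonneg (F₂ z)]
  have b2 : ∀ z, nsq (F₂ z) ≤ (1 + normSq z) ^ 4 := by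
    intro z
    linarith [hAr z, hi_cs (F₁ z) (F₂ z), nsq_nonneg (F₁ z)]
  obtain ⟨a, a0, a5, rfl⟩ := poly_coeffs F₁ hF₁ h01 b1
  obtain ⟨b, b0, b5, rfl⟩ := poly_coeffs F₂ hF₂ h02 b2
  refine ⟨a, b, rfl, rfl, good_of_diag a b c a0 b0 a5 b5 ?_ ?_⟩
  · intro z
    have := hA z
    rw [hi_conj, ← mul_conj] at this
    exact this
  · intro z
    have := hB z
    rw [deriv_vOne a a5, deriv_vTwo b b5, gram, ← mul_conj] at this
    refine Eq.trans ?_ this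
    rw [bigG_eq]
    congr 1
    ext i j
    fin_cases i <;> fin_cases j <;> simp [vOne, vTwo, hi_cons]


theorem isom_exists {m m' : ℕ} {ι : Type} (x : ι → Fin m → ℂ) (y : ι → Fin m' → ℂ)
    (hg : ∀ i j, hinner (x i) (x j) = hinner (y i) (y j))
    (hx : Submodule.span ℂ (Set.range x) = ⊤) (hy : Submodule.span ℂ (Set.range y) = ⊤) :
    ∃ L : (Fin m → ℂ) ≃ₗ[ℂ] (Fin m' → ℂ), (∀ i, L (x i) = y i) ∧
      ∀ u w, hinner (L u) (L w) = hinner u w := by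
  classical
  let X := Finsupp.linearCombination ℂ x
  let Y := Finsupp.linearCombination ℂ y
  have hX : Function.Surjective X := by
    rw [← LinearMap.range_eq_top, Finsupp.range_linearCombination, hx]
  have hY : Function.Surjective Y := by
    rw [← LinearMap.range_eq_top, Finsupp.range_linearCombination, hy]
  have hXY : ∀ f g, hinner (X f) (X g) = hinner (Y f) (Y g) := by
    intro f g
    simp only [X, Y, Finsupp.linearCombination_apply, Finsupp.sum]
    simp only [hi_sum_left, hi_sum_right, hi_smul_left, hi_smul_right, hg]
  have hk : LinearMap.ker X = LinearMap.ker Y := by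
    ext f
    rw [LinearMap.mem_ker, LinearMap.mem_ker]
    constructor
    · intro h
      apply hi_self_eq_zero
      rw [← hXY, h, hi_zero_left]
    · intro h
      apply hi_self_eq_zero
      rw [hXY, h, hi_zero_left]
  let L := (X.quotKerEquivOfSurjective hX).symm ≪≫ₗ (Submodule.quotEquivOfEq _ _ hk) ≪≫ₗ
    (Y.quotKerEquivOfSurjective hY)
  have hL : ∀ f, L (X f) = Y f := by
    intro f
    have : (X.quotKerEquivOfSurjective hX).symm (X f) = Submodule.Quotient.mk f := by
      rw [LinearEquiv.symm_apply_eq]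
      rfl
    simp only [L, LinearEquiv.trans_apply, this]
    rfl
  refine ⟨L, ?_, ?_⟩
  · intro i
    have := hL (Finsupp.single i 1)
    simpa [X, Y] using this
  · intro u w
    obtain ⟨f, rfl⟩ := hX u
    obtain ⟨g, rfl⟩ := hX w
    rw [hL, hL, hXY]

theorem unit_of_isom {m : ℕ} (L : (Fin m → ℂ) →ₗ[ℂ] (Fin m → ℂ))
    (h : ∀ u w, hinner (L u) (L w) = hinner u w) :
    LinearMap.toMatrix' L ∈ Matrix.unitaryGroup (Fin m) ℂ := by
  rw [Matrix.mem_unitaryGroup_iff']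
  ext i j
  have := h (Pi.single j 1) (Pi.single i 1)
  rw [Matrix.mul_apply]
  have e : hinner (Pi.single j 1 : Fin m → ℂ) (Pi.single i 1) = (1 : Matrix (Fin m) (Fin m) ℂ) i j := by
    simp [hinner, Pi.single_apply, Matrix.one_apply]
  rw [← e, ← this]
  simp [hinner, LinearMap.toMatrix'_apply, Matrix.star_apply, mul_comm]

theorem model_span (t : ℝ) (ht0 : 0 < t) (ht3 : t ≤ 3) (ι : ℂ ⊕ ℂ → Fin 6 → ℂ)
    (h1 : ∀ z, ι (Sum.inl z) = v1t t z) (h2 : ∀ z, ι (Sum.inr z) = v2t t z) :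
    Submodule.span ℂ (Set.range ι) = ⊤ := by
  by_contra hne
  obtain ⟨f, hf, hle⟩ := Submodule.exists_le_ker_of_lt_top _ (lt_top_iff_ne_top.2 hne)
  apply hf
  have hv : ∀ i, f (ι i) = 0 := fun i => hle (Submodule.subset_span ⟨i, rfl⟩)
  have hs : ∀ v : Fin 6 → ℂ, f v = ∑ i, v i * f (Pi.single i 1) := by
    intro v
    rw [LinearMap.pi_apply_eq_sum_univ f v]
    simp only [smul_eq_mul]
    refine Finset.sum_congr rfl fun i _ => ?_
    congr 2
    funext j
    simp [Pi.single_apply, eq_comm]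
  generalize hφ : (fun i : Fin 6 => f (Pi.single i 1)) = φ at *
  have hφ' : ∀ i, f (Pi.single i 1) = φ i := fun i => congrFun hφ i
  have e1 : ∀ z : ℂ, φ 0 + ((|t - 2| : ℝ) * z ^ 3 * φ 2 + (Real.sqrt t : ℝ) * z * φ 3 +
      ((Real.sqrt ((3 - t) / (4 - t)) * |t - 2| : ℝ)) * z ^ 2 * φ 4 +
      ((Real.sqrt (t / (4 - t)) : ℝ)) * z ^ 2 * φ 5) = 0 := by
    intro z
    have := hv (Sum.inl z)
    rw [h1, hs] at this
    simp only [hφ', v1t, vOne, F1t] at this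
    rw [Fin.sum_univ_succ, Fin.sum_univ_succ, Fin.sum_univ_four] at this
    simp at this
    rw [← this]
    push_cast
    simp only [show (Fin.succ (Fin.succ 0) : Fin 6) = 2 from rfl, show (Fin.succ (Fin.succ 1) : Fin 6) = 3 from rfl,
      show (Fin.succ (Fin.succ 2) : Fin 6) = 4 from rfl, show (Fin.succ (Fin.succ 3) : Fin 6) = 5 from rfl]
  have e2 : ∀ z : ℂ, φ 1 + ((Real.sqrt (3 - t) : ℝ) * z ^ 2 * φ 2 + (Real.sqrt (4 - t) : ℝ) * z * φ 4) = 0 := by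
    intro z
    have := hv (Sum.inr z)
    rw [h2, hs] at this
    simp only [hφ', v2t, vTwo, F2t] at this
    rw [Fin.sum_univ_succ, Fin.sum_univ_succ, Fin.sum_univ_four] at this
    simp at this
    rw [← this]
  have p0 : φ 0 = 0 := by linear_combination e1 0
  have p1 : φ 1 = 0 := by linear_combination e2 0
  have q3 : ((|t - 2| : ℝ) : ℂ) * φ 2 = 0 := by linear_combination (e1 2 - 3 * e1 1 + 3 * e1 0 - e1 (-1)) / 6
  have r2 : ((Real.sqrt (3 - t) : ℝ) : ℂ) * φ 2 = 0 := by linear_combination (e2 1 + e2 (-1)) / 2 - e2 0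
  have r1 : ((Real.sqrt (4 - t) : ℝ) : ℂ) * φ 4 = 0 := by linear_combination (e2 1 - e2 (-1)) / 2
  have q1 : ((Real.sqrt t : ℝ) : ℂ) * φ 3 = 0 := by linear_combination (e1 1 - e1 (-1)) / 2 - q3
  have p4 : φ 4 = 0 := by
    refine (mul_eq_zero.1 r1).resolve_left ?_
    exact_mod_cast (Real.sqrt_pos.2 (by linarith)).ne'
  have p3 : φ 3 = 0 := by
    refine (mul_eq_zero.1 q1).resolve_left ?_
    exact_mod_cast (Real.sqrt_pos.2 ht0).ne'
  have p2 : φ 2 = 0 := by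
    rcases mul_eq_zero.1 q3 with h | h
    · refine (mul_eq_zero.1 r2).resolve_left ?_
      have : t - 2 = 0 := abs_eq_zero.1 (by exact_mod_cast h)
      exact_mod_cast (Real.sqrt_pos.2 (by linarith)).ne'
    · exact h
  have p5 : φ 5 = 0 := by
    have : ((Real.sqrt (t / (4 - t)) : ℝ) : ℂ) * φ 5 = 0 := by
      have := e1 1
      have h' := e1 (-1)
      rw [p4] at this h'
      linear_combination (this + h') / 2 - e1 0
    refine (mul_eq_zero.1 this).resolve_left ?_
    exact_mod_cast (Real.sqrt_pos.2 (div_pos ht0 (by linarith))).ne'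
  apply LinearMap.ext
  intro v
  rw [hs]
  apply Finset.sum_eq_zero
  intro i _
  rw [hφ']
  fin_cases i <;> simp [p0, p1, p2, p3, p4, p5]

theorem F_aa (t : ℝ) (ht0 : 0 < t) (ht3 : t ≤ 3) (z w : ℂ) : hinner (F1t t z) (F1t t w) =
    (t - 2) ^ 2 * (z * (starRingEnd ℂ) w) ^ 3 + t * (z * (starRingEnd ℂ) w)
      + (t ^ 2 - 3 * t + 3) * (z * (starRingEnd ℂ) w) ^ 2 := by
  have s1 : (Real.sqrt t : ℂ) * Real.sqrt t = t := by exact_mod_cast Real.mul_self_sqrt ht0.le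
  have s2 : ((|t - 2| : ℝ) : ℂ) * (|t - 2| : ℝ) = (t - 2) ^ 2 := by
    rw [← pow_two]; exact_mod_cast sq_abs (t - 2)
  have s3 : (Real.sqrt ((3 - t) / (4 - t)) : ℂ) * Real.sqrt ((3 - t) / (4 - t)) * (t - 2) ^ 2 +
      (Real.sqrt (t / (4 - t)) : ℂ) * Real.sqrt (t / (4 - t)) = t ^ 2 - 3 * t + 3 := by
    have h4 : 4 - t ≠ 0 := by linarith
    have : Real.sqrt ((3 - t) / (4 - t)) * Real.sqrt ((3 - t) / (4 - t)) * (t - 2) ^ 2 +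
      Real.sqrt (t / (4 - t)) * Real.sqrt (t / (4 - t)) = t ^ 2 - 3 * t + 3 := by
      rw [Real.mul_self_sqrt (div_nonneg (by linarith) (by linarith)),
        Real.mul_self_sqrt (div_nonneg (by linarith) (by linarith))]
      field_simp
      ring
    exact_mod_cast this
  simp only [hinner, F1t, Fin.sum_univ_four]
  simp
  linear_combination (z * (starRingEnd ℂ) w) * s1 + ((z * (starRingEnd ℂ) w) ^ 3 + (Real.sqrt ((3 - t) / (4 - t)) : ℂ) * Real.sqrt ((3 - t) / (4 - t)) * (z * (starRingEnd ℂ) w) ^ 2) * s2 + (z * (starRingEnd ℂ) w) ^ 2 * s3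

theorem F_bb (t : ℝ) (ht0 : 0 < t) (ht3 : t ≤ 3) (z w : ℂ) : hinner (F2t t z) (F2t t w) =
    (3 - t) * (z * (starRingEnd ℂ) w) ^ 2 + (4 - t) * (z * (starRingEnd ℂ) w) := by
  have s1 : (Real.sqrt (3 - t) : ℂ) * Real.sqrt (3 - t) = 3 - t := by
    exact_mod_cast Real.mul_self_sqrt (show 0 ≤ 3 - t by linarith)
  have s2 : (Real.sqrt (4 - t) : ℂ) * Real.sqrt (4 - t) = 4 - t := by
    exact_mod_cast Real.mul_self_sqrt (show 0 ≤ 4 - t by linarith)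
  simp only [hinner, F2t, Fin.sum_univ_four]
  simp
  linear_combination (z * (starRingEnd ℂ) w) ^ 2 * s1 + (z * (starRingEnd ℂ) w) * s2

theorem F_ab (t : ℝ) (ht0 : 0 < t) (ht3 : t ≤ 3) (z w : ℂ) : hinner (F1t t z) (F2t t w) =
    ((|t - 2| * Real.sqrt (3 - t) : ℝ) : ℂ) *
      (z ^ 3 * (starRingEnd ℂ) w ^ 2 + z ^ 2 * (starRingEnd ℂ) w) := by
  have s1 : (Real.sqrt ((3 - t) / (4 - t)) : ℂ) * Real.sqrt (4 - t) = Real.sqrt (3 - t) := by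
    have h4 : 4 - t ≠ 0 := by linarith
    have : Real.sqrt ((3 - t) / (4 - t)) * Real.sqrt (4 - t) = Real.sqrt (3 - t) := by
      rw [← Real.sqrt_mul (div_nonneg (by linarith) (by linarith)), div_mul_cancel₀ _ h4]
    exact_mod_cast this
  simp only [hinner, F1t, F2t, Fin.sum_univ_four]
  simp
  linear_combination ((|t - 2| : ℝ) : ℂ) * z ^ 2 * (starRingEnd ℂ) w * s1


theorem comb_cons {n : ℕ} (F₁ F₂ : ℂ → Fin n → ℂ) (p q z : ℂ) :
    p • vOne F₁ z + q • vTwo F₂ z = Fin.cons p (Fin.cons q (p • F₁ z + q • F₂ z)) := by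
  funext i
  refine Fin.cases ?_ (fun j => Fin.cases ?_ (fun k => ?_) j) i <;> simp [vOne, vTwo]

theorem stmt0 (n : ℕ) (hn : 2 ≤ n) (F₁ F₂ : ℂ → Fin n → ℂ)
    (hF₁ : IsPolyMap F₁) (hF₂ : IsPolyMap F₂)
    (h01 : F₁ 0 = 0) (h02 : F₂ 0 = 0)
    (hfull : Submodule.span ℂ (Set.range (vOne F₁) ∪ Set.range (vTwo F₂)) = ⊤)
    (c : ℝ) (hc : 0 < c)
    (hA : CondA 4 F₁ F₂) (hB : CondB 4 c F₁ F₂) :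
    ∃ hn4 : n = 4, ∃ t ∈ Set.Ioc (0 : ℝ) 3,
      c = 4 * t - t ^ 2 ∧
      ∃ U : Matrix (Fin (n + 2)) (Fin (n + 2)) ℂ,
        U ∈ Matrix.unitaryGroup (Fin (n + 2)) ℂ ∧
        ∀ z : ℂ,
          Submodule.span ℂ {U.mulVec (vOne F₁ z), U.mulVec (vTwo F₂ z)} =
            Submodule.span ℂ
              {v1t t z ∘ Fin.cast (by omega), v2t t z ∘ Fin.cast (by omega)} := by
  obtain ⟨a, b, e1, e2, hG⟩ := start F₁ F₂ hF₁ hF₂ h01 h02 c hA hB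
  obtain ⟨t, t0, t3, tc, p, q, r, s, U, M⟩ := core hG hc
  let x : ℂ ⊕ ℂ → Fin (n + 2) → ℂ :=
    Sum.elim (fun z => p • vOne F₁ z + q • vTwo F₂ z) (fun z => r • vOne F₁ z + s • vTwo F₂ z)
  let y : ℂ ⊕ ℂ → Fin 6 → ℂ := Sum.elim (v1t t) (v2t t)
  have x1 : ∀ z, x (Sum.inl z) = Fin.cons p (Fin.cons q (sqv (rot p q a b) z)) := by
    intro z
    rw [sqv_rot, ← e1, ← e2, ← comb_cons]; rfl
  have x2 : ∀ z, x (Sum.inr z) = Fin.cons r (Fin.cons s (sqv (rot r s a b) z)) := by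
    intro z
    rw [sqv_rot, ← e1, ← e2, ← comb_cons]; rfl
  have y1 : ∀ z, y (Sum.inl z) = Fin.cons 1 (Fin.cons 0 (F1t t z)) := fun z => rfl
  have y2 : ∀ z, y (Sum.inr z) = Fin.cons 0 (Fin.cons 1 (F2t t z)) := fun z => rfl
  have inv1 : ∀ z, vOne F₁ z = (starRingEnd ℂ) p • x (Sum.inl z) + (starRingEnd ℂ) r • x (Sum.inr z) := by
    intro z
    have : (starRingEnd ℂ) p • x (Sum.inl z) + (starRingEnd ℂ) r • x (Sum.inr z) =
        (p * (starRingEnd ℂ) p + r * (starRingEnd ℂ) r) • vOne F₁ z +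
        (q * (starRingEnd ℂ) p + s * (starRingEnd ℂ) r) • vTwo F₂ z := by
      simp only [x, Sum.elim_inl, Sum.elim_inr]
      module
    rw [this, U.c1, U.c4, one_smul, zero_smul, add_zero]
  have inv2 : ∀ z, vTwo F₂ z = (starRingEnd ℂ) q • x (Sum.inl z) + (starRingEnd ℂ) s • x (Sum.inr z) := by
    intro z
    have : (starRingEnd ℂ) q • x (Sum.inl z) + (starRingEnd ℂ) s • x (Sum.inr z) =
        (p * (starRingEnd ℂ) q + r * (starRingEnd ℂ) s) • vOne F₁ z +
        (q * (starRingEnd ℂ) q + s * (starRingEnd ℂ) s) • vTwo F₂ z := by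
      simp only [x, Sum.elim_inl, Sum.elim_inr]
      module
    rw [this, U.c2, U.c3, one_smul, zero_smul, zero_add]
  have hx : Submodule.span ℂ (Set.range x) = ⊤ := by
    rw [eq_top_iff, ← hfull, Submodule.span_le]
    rintro v (⟨z, rfl⟩ | ⟨z, rfl⟩)
    · rw [inv1]
      exact Submodule.add_mem _ (Submodule.smul_mem _ _ (Submodule.subset_span ⟨_, rfl⟩))
        (Submodule.smul_mem _ _ (Submodule.subset_span ⟨_, rfl⟩))
    · rw [inv2]
      exact Submodule.add_mem _ (Submodule.smul_mem _ _ (Submodule.subset_span ⟨_, rfl⟩))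
        (Submodule.smul_mem _ _ (Submodule.subset_span ⟨_, rfl⟩))
  have hy : Submodule.span ℂ (Set.range y) = ⊤ :=
    model_span t t0 t3 y (fun z => rfl) (fun z => rfl)
  have hg11 : ∀ z w, hinner (x (Sum.inl z)) (x (Sum.inl w)) = hinner (y (Sum.inl z)) (y (Sum.inl w)) := by
    intro z w
    rw [x1, x1, y1, y1]
    simp only [hi_cons, M.aa, F_aa t t0 t3, map_one, map_zero]
    linear_combination U.r1
  have hg22 : ∀ z w, hinner (x (Sum.inr z)) (x (Sum.inr w)) = hinner (y (Sum.inr z)) (y (Sum.inr w)) := by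
    intro z w
    rw [x2, x2, y2, y2]
    simp only [hi_cons, M.bb, F_bb t t0 t3, map_one, map_zero]
    linear_combination U.r2
  have hg12 : ∀ z w, hinner (x (Sum.inl z)) (x (Sum.inr w)) = hinner (y (Sum.inl z)) (y (Sum.inr w)) := by
    intro z w
    rw [x1, x2, y1, y2]
    simp only [hi_cons, M.ab, F_ab t t0 t3, map_one, map_zero]
    linear_combination U.r3
  have hg : ∀ i j, hinner (x i) (x j) = hinner (y i) (y j) := by
    rintro (z | z) (w | w)
    · exact hg11 z w
    · exact hg12 z w
    · rw [← hi_conj, hg12 w z, hi_conj]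
    · exact hg22 z w
  obtain ⟨L, hL, hiso⟩ := isom_exists x y hg hx hy
  have hdim : n + 2 = 6 := by
    have := L.finrank_eq
    simpa using this
  have hn4 : n = 4 := by omega
  subst hn4
  refine ⟨rfl, t, ⟨t0, t3⟩, tc, LinearMap.toMatrix' (L : (Fin 6 → ℂ) →ₗ[ℂ] (Fin 6 → ℂ)),
    unit_of_isom (L : (Fin 6 → ℂ) →ₗ[ℂ] (Fin 6 → ℂ)) hiso, ?_⟩
  intro z
  rw [LinearMap.toMatrix'_mulVec, LinearMap.toMatrix'_mulVec]
  have c1 : v1t t z ∘ Fin.cast (by omega) = v1t t z := rfl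
  have c2 : v2t t z ∘ Fin.cast (by omega) = v2t t z := rfl
  show Submodule.span ℂ {L (vOne F₁ z), L (vTwo F₂ z)} = Submodule.span ℂ {v1t t z, v2t t z}
  have l1 : v1t t z = p • L (vOne F₁ z) + q • L (vTwo F₂ z) := by
    rw [← map_smul, ← map_smul, ← map_add]
    exact (hL (Sum.inl z)).symm
  have l2 : v2t t z = r • L (vOne F₁ z) + s • L (vTwo F₂ z) := by
    rw [← map_smul, ← map_smul, ← map_add]
    exact (hL (Sum.inr z)).symm
  have k1 : L (vOne F₁ z) = (starRingEnd ℂ) p • v1t t z + (starRingEnd ℂ) r • v2t t z := by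
    rw [inv1, map_add, map_smul, map_smul, hL, hL]; rfl
  have k2 : L (vTwo F₂ z) = (starRingEnd ℂ) q • v1t t z + (starRingEnd ℂ) s • v2t t z := by
    rw [inv2, map_add, map_smul, map_smul, hL, hL]; rfl
  apply le_antisymm
  · rw [Submodule.span_le]
    rintro v (rfl | rfl)
    · exact Submodule.mem_span_pair.2 ⟨_, _, k1.symm⟩
    · exact Submodule.mem_span_pair.2 ⟨_, _, k2.symm⟩
  · rw [Submodule.span_le]
    rintro v (rfl | rfl)
    · exact Submodule.mem_span_pair.2 ⟨_, _, l1.symm⟩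
    · exact Submodule.mem_span_pair.2 ⟨_, _, l2.symm⟩
end

section
/- Let t ∈ (0,3] and θ ∈ (0, π/2] satisfy t = 3·sin²θ. Define u₁(z) = (1, √3·z, √3·z², z³, 0, 0) ∈ ℂ⁶ and u₂(z) = cosθ·(−3·conj(z), √3·(1−2|z|²), √3·z·(2−|z|²), 3z², 0, 0)/(√3·(1+|z|²)^{3/2}) + sinθ·(0,0,0,0,1,z)/(1+|z|²)^{1/2} ∈ ℂ⁶. Then there exists a unitary matrix U ∈ U(6) such that for every z ∈ ℂ, span_ℂ{U v₁ᵗ(z), U v₂ᵗ(z)} = span_ℂ{u₁(z), u₂(z)}. (That is, the curve of the family (1.2) with parameter t is unitarily congruent to the homogeneous holomorphic two-sphere V₀⁽³⁾ ⊕ (cosθ·V₁⁽³⁾ + sinθ·V₀⁽¹⁾) in G(2,6).) -/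
open scoped BigOperators
open Complex

lemma span_aux {E : Type*} [AddCommGroup E] [Module ℂ E] (a b x y : E) (σ p k m : ℂ)
    (hσ : σ * σ = 1) (hk : k ≠ 0) (hx : x = σ • (a - p • b)) (hy : y = k • (b - m • a)) :
    Submodule.span ℂ {x, b} = Submodule.span ℂ {a, y} := by
  have hA : Submodule.span ℂ {x, b} = Submodule.span ℂ {a, b} := by
    apply le_antisymm <;> rw [Submodule.span_le] <;> rintro v (rfl | rfl) <;>
      rw [SetLike.mem_coe, Submodule.mem_span_pair]
    · exact ⟨σ, -(σ * p), by rw [hx]; module⟩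
    · exact ⟨0, 1, by module⟩
    · refine ⟨σ, p, ?_⟩
      rw [hx, smul_smul, hσ]; module
    · exact ⟨0, 1, by module⟩
  have hB : Submodule.span ℂ {a, y} = Submodule.span ℂ {a, b} := by
    apply le_antisymm <;> rw [Submodule.span_le] <;> rintro v (rfl | rfl) <;>
      rw [SetLike.mem_coe, Submodule.mem_span_pair]
    · exact ⟨1, 0, by module⟩
    · exact ⟨-(k * m), k, by rw [hy]; module⟩
    · exact ⟨1, 0, by module⟩
    · refine ⟨m, k⁻¹, ?_⟩
      rw [hy, smul_smul, inv_mul_cancel₀ hk]; module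
  rw [hA, hB]

theorem stmt2 (t θ : ℝ) (ht : t ∈ Set.Ioc (0 : ℝ) 3)
    (hθ : θ ∈ Set.Ioc (0 : ℝ) (Real.pi / 2))
    (htθ : t = 3 * Real.sin θ ^ 2) :
    ∃ U : Matrix (Fin 6) (Fin 6) ℂ, U ∈ Matrix.unitaryGroup (Fin 6) ℂ ∧
      ∀ z : ℂ,
        Submodule.span ℂ {U.mulVec (v1t t z), U.mulVec (v2t t z)} =
          Submodule.span ℂ
            { (![1, (Real.sqrt 3 : ℝ) * z, (Real.sqrt 3 : ℝ) * z ^ 2, z ^ 3, 0, 0] :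
                Fin 6 → ℂ),
              ((Real.cos θ / (Real.sqrt 3 * (1 + Complex.normSq z) ^ ((3 : ℝ) / 2)) : ℝ) : ℂ) •
                  (![-3 * (starRingEnd ℂ) z,
                     (Real.sqrt 3 : ℝ) * (1 - 2 * (Complex.normSq z : ℂ)),
                     (Real.sqrt 3 : ℝ) * z * (2 - (Complex.normSq z : ℂ)),
                     3 * z ^ 2, 0, 0] : Fin 6 → ℂ) +
                ((Real.sin θ / (1 + Complex.normSq z) ^ ((1 : ℝ) / 2) : ℝ) : ℂ) •
                  (![0, 0, 0, 0, 1, z] : Fin 6 → ℂ) } := by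
  obtain ⟨ht0, ht3⟩ := ht
  have hs : 0 < Real.sin θ :=
    Real.sin_pos_of_pos_of_lt_pi hθ.1 (by linarith [hθ.2, Real.pi_pos])
  have hc : 0 ≤ Real.cos θ :=
    Real.cos_nonneg_of_neg_pi_div_two_le_of_le (by linarith [hθ.1, Real.pi_pos]) hθ.2
  have hsc := Real.sin_sq_add_cos_sq θ
  generalize Real.sin θ = s at *
  generalize Real.cos θ = c at *
  obtain ⟨p, hp⟩ : ∃ p, p = Real.sqrt 3 := ⟨_, rfl⟩
  have hp2 : p * p = 3 := by rw [hp]; exact Real.mul_self_sqrt (by norm_num)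
  have hp0 : 0 < p := by rw [hp]; positivity
  obtain ⟨q, hq⟩ : ∃ q, q = Real.sqrt (4 - t) := ⟨_, rfl⟩
  have hq2' : q * q = 4 - t := by rw [hq]; exact Real.mul_self_sqrt (by linarith)
  have hq2 : q * q = 4 - 3 * s ^ 2 := by rw [hq2', htθ]
  have hq0 : 0 < q := by rw [hq]; exact Real.sqrt_pos.2 (by linarith)
  have e1 : Real.sqrt t = p * s := by
    rw [Real.sqrt_eq_iff_mul_self_eq_of_pos (by positivity)]
    rw [htθ]; linear_combination s ^ 2 * hp2
  have e2 : Real.sqrt (3 - t) = p * c := by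
    rw [Real.sqrt_eq_iff_mul_self_eq (by linarith) (by positivity)]
    rw [htθ]; linear_combination -c ^ 2 * hp2 - 3 * hsc
  have e3 : Real.sqrt ((3 - t) / (4 - t)) = p * c / q := by
    rw [Real.sqrt_div (by linarith), e2, ← hq]
  have e4 : Real.sqrt (t / (4 - t)) = p * s / q := by
    rw [Real.sqrt_div (by linarith), e1, ← hq]
  obtain ⟨σ, hσ, e5⟩ : ∃ σ : ℝ, σ * σ = 1 ∧ |t - 2| = σ * (3 * s ^ 2 - 2) := by
    rcases le_total 0 (t - 2) with h | h
    · exact ⟨1, by norm_num, by rw [abs_of_nonneg h, htθ]; ring⟩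
    · exact ⟨-1, by norm_num, by rw [abs_of_nonpos h, htθ]; ring⟩
  have hpC : (p : ℂ) * p = 3 := by exact_mod_cast hp2
  have hqC : (q : ℂ) * q = 4 - 3 * s ^ 2 := by exact_mod_cast hq2
  have hσC : (σ : ℂ) * σ = 1 := by exact_mod_cast hσ
  have hscC : (s : ℂ) ^ 2 + c ^ 2 = 1 := by exact_mod_cast hsc
  have hq0C : (q : ℂ) ≠ 0 := by exact_mod_cast hq0.ne'
  have hp0C : (p : ℂ) ≠ 0 := by exact_mod_cast hp0.ne'
  obtain ⟨r, hr⟩ : ∃ r : ℝ, r = q⁻¹ := ⟨_, rfl⟩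
  have hrC : (r : ℂ) * q = 1 := by rw [hr]; push_cast; exact inv_mul_cancel₀ hq0C
  have hr2 : (r : ℂ) * r * (4 - 3 * s ^ 2) = 1 := by
    rw [← hqC]; linear_combination (r * q + 1 : ℂ) * hrC
  simp only [v1t, v2t, vOne, vTwo, F1t, F2t, e1, e2, e3, e4, e5, ← hp, ← hq, div_eq_mul_inv _ q, ← hr]
  refine ⟨!![(σ : ℂ), 0, 0, 0, 0, 0;
             0, c, 0, σ * s, 0, 0;
             0, 0, 0, 0, 2 * c * r, σ * s * r;
             0, 0, 1, 0, 0, 0;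
             0, s, 0, -σ * c, 0, 0;
             0, 0, 0, 0, s * r, -2 * σ * c * r], ?_, ?_⟩
  · clear hp hq hr e1 e2 e3 e4 e5 hq2 hq2' hp2 hsc hσ
    rw [Matrix.mem_unitaryGroup_iff]
    have h2 : (starRingEnd ℂ) 2 = 2 := Complex.conj_ofNat 2
    ext i j
    fin_cases i <;> fin_cases j <;>
      simp [Matrix.mul_apply, Fin.sum_univ_succ, Matrix.star_apply, h2]
    all_goals grind
  · clear hp hq hr e1 e2 e3 e4 e5 hq2 hq2' hp2 hsc hσ
    intro z
    have hn : 0 < 1 + Complex.normSq z := by have := Complex.normSq_nonneg z; linarith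
    have hzz : (Complex.normSq z : ℂ) = z * (starRingEnd ℂ) z := (Complex.mul_conj z).symm
    have hpow : (1 + Complex.normSq z) ^ ((3 : ℝ) / 2) =
        (1 + Complex.normSq z) * (1 + Complex.normSq z) ^ ((1 : ℝ) / 2) := by
      rw [show (3 : ℝ) / 2 = 1 + 1 / 2 by norm_num, Real.rpow_add hn, Real.rpow_one]
    rw [hpow]
    have hk := Real.rpow_pos_of_pos hn ((1 : ℝ) / 2)
    generalize (1 + Complex.normSq z) ^ ((1 : ℝ) / 2) = k at *
    have hkC : (k : ℂ) ≠ 0 := by exact_mod_cast hk.ne'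
    have hnC : (1 + (Complex.normSq z : ℂ)) ≠ 0 := by exact_mod_cast hn.ne'
    have key : ∀ (x y a b d : Fin 6 → ℂ), d = b → x = (σ : ℂ) • (a - ((p : ℂ) * c * z) • b) →
        y = ((k : ℂ)⁻¹) • (b - ((p : ℂ) * c * (starRingEnd ℂ) z / (1 + (Complex.normSq z : ℂ))) • a) →
        Submodule.span ℂ {x, d} = Submodule.span ℂ {a, y} := by
      intro x y a b d hd hx hy
      rw [hd]
      exact span_aux a b x y _ _ _ _ hσC (inv_ne_zero hkC) hx hy
    apply key _ _ _ ![0, (c : ℂ), 2 * c * z, p * c * z ^ 2, s, s * z]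
    · ext i
      fin_cases i <;> simp [Matrix.mulVec, dotProduct, Fin.sum_univ_succ, Fin.cons]
      all_goals grind
    · ext i
      fin_cases i <;> simp [Matrix.mulVec, dotProduct, Fin.sum_univ_succ, Fin.cons]
      all_goals grind
    · ext i
      fin_cases i <;> simp
      all_goals try rw [hzz] at hnC ⊢
      all_goals field_simp
      all_goals grind
end
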